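/- Let Γ be a finite connected simple graph all of whose edge labels are even and ≥ 6, and suppose Γ admits an admissible partial orientation (equivalently, an orientation of all its edges with no almost misdirected cycle). Then the Artin group Art_Γ is residually finite. -/

import Mathlib

/-- The alternating word (a,b)_M = abab⋯ of length M in the free group. -/
def altWord {V : Type} (a b : V) (M : ℕ) : FreeGroup V :=
  ((List.range M).map fun i => if i % 2 = 0 then FreeGroup.of a else FreeGroup.of b).prod

/-- The Artin relators of a labelled graph: one relator `(a,b)_{M a b} ((b,a)_{M a b})⁻¹`
for each edge `{a,b}` of `Γ`. -/
def artinRels {V : Type} (Γ : SimpleGraph V) (M : V → V → ℕ) : Set (FreeGroup V) :=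
  {r | ∃ a b, Γ.Adj a b ∧ r = altWord a b (M a b) * (altWord b a (M a b))⁻¹}

/-- The Artin group of a labelled graph. -/
abbrev ArtinGroup {V : Type} (Γ : SimpleGraph V) (M : V → V → ℕ) : Type :=
  PresentedGroup (artinRels Γ M)

/-- `c : ZMod n → V` is a cycle in `Γ`: a closed walk with no backtracking
(a combinatorial immersion of the `n`-cycle); it need not be embedded. -/
structure SimpleGraph.IsCycleMap {V : Type} (Γ : SimpleGraph V) {n : ℕ} (c : ZMod n → V) : Prop where
  adj : ∀ i, Γ.Adj (c i) (c (i + 1))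
  no_backtrack : ∀ i, c (i + 2) ≠ c i

/-- `p 0, p 1, …, p k` is a path (walk without backtracking) of length `k` in `Γ`. -/
def SimpleGraph.IsPathMap {V : Type} (Γ : SimpleGraph V) (k : ℕ) (p : ℕ → V) : Prop :=
  (∀ i < k, Γ.Adj (p i) (p (i + 1))) ∧ (∀ i, i + 2 ≤ k → p (i + 2) ≠ p i)

/-- A partial orientation of the edges of `Γ`: `D a b` means the edge `{a,b}` is
oriented with initial vertex `a`. -/
structure IsPartialOrientation {V : Type} (Γ : SimpleGraph V) (D : V → V → Prop) : Prop where
  adj : ∀ a b, D a b → Γ.Adj a b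
  not_both : ∀ a b, ¬ (D a b ∧ D b a)

/-- The path `p 0, …, p k` in `Γ` is misdirected with respect to the partial orientation `D`:
it has length at least 2, and the partial orientation induced on its edges extends to a full
orientation of its edges (recorded by `s i = true` iff the `i`-th edge points from `p i` to
`p (i+1)`) in which every maximal directed subpath has length 1, i.e. the directions alternate. -/
def MisdirectedPath {V : Type} (Γ : SimpleGraph V) (D : V → V → Prop) (k : ℕ) (p : ℕ → V) :
    Prop :=
  2 ≤ k ∧ Γ.IsPathMap k p ∧ ∃ s : ℕ → Bool,
    (∀ i, i + 1 < k → s (i + 1) = !(s i)) ∧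
    (∀ i < k, (D (p i) (p (i + 1)) → s i = true) ∧ (D (p (i + 1)) (p i) → s i = false))

/-- The cycle `c : ZMod n → V` is almost misdirected with respect to `D`:
it can be written as `(a₁, …, aₙ, a₁)` where the path `(a₁, …, aₙ)` is misdirected. -/
def AlmostMisdirectedCycle {V : Type} (Γ : SimpleGraph V) (D : V → V → Prop)
    (n : ℕ) (c : ZMod n → V) : Prop :=
  Γ.IsCycleMap c ∧ MisdirectedPath Γ D (n - 1) (fun i => c (i : ZMod n))

/-- An admissible partial orientation of a labelled graph: it is defined exactly on the
edges with label ≥ 3, and no cycle of `Γ` is almost misdirected. -/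
structure IsAdmissibleOrientation {V : Type} (Γ : SimpleGraph V) (M : V → V → ℕ)
    (D : V → V → Prop) : Prop where
  adj : ∀ a b, D a b → Γ.Adj a b
  not_both : ∀ a b, ¬ (D a b ∧ D b a)
  defined_iff : ∀ a b, Γ.Adj a b → ((D a b ∨ D b a) ↔ 3 ≤ M a b)
  no_almost_misdirected : ∀ (n : ℕ), 0 < n → ∀ c : ZMod n → V,
    ¬ AlmostMisdirectedCycle Γ D n c

/-- `Γ` is bipartite: the vertices can be partitioned into two sets such that
every edge joins the two sets. -/
def IsBipartite {V : Type} (Γ : SimpleGraph V) : Prop :=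
  ∃ S : Set V, ∀ a b, Γ.Adj a b → (a ∈ S ↔ b ∉ S)

/-- A group is residually finite if every nontrivial element survives in some finite quotient. -/
def ResiduallyFinite (G : Type*) [Group G] : Prop :=
  ∀ g : G, g ≠ 1 → ∃ (Q : Type) (_ : Group Q) (_ : Finite Q) (φ : G →* Q), φ g ≠ 1

section

namespace RFArt

theorem RF_of_injective {G H : Type} [Group G] [Group H] (f : G →* H)
    (hf : Function.Injective f) (h : ResiduallyFinite H) : ResiduallyFinite G := by
  intro g hg
  obtain ⟨Q, i1, i2, φ, hφ⟩ := h (f g) (fun h' => hg (hf (by simpa using h')))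
  exact ⟨Q, i1, i2, φ.comp f, hφ⟩

theorem RF_of_leftInverse {G H : Type} [Group G] [Group H] (f : G →* H) (k : H →* G)
    (hk : ∀ x, k (f x) = x) (h : ResiduallyFinite H) : ResiduallyFinite G :=
  RF_of_injective f (Function.LeftInverse.injective hk) h

theorem RF_of_perm {G : Type} [Group G] {X : Type} [Finite X] (g : G)
    (φ : G →* Equiv.Perm X) (h : φ g ≠ 1) :
    ∃ (Q : Type) (_ : Group Q) (_ : Finite Q) (φ : G →* Q), φ g ≠ 1 :=
  ⟨Equiv.Perm X, inferInstance, inferInstance, φ, h⟩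

/-- Partial left multiplication on a finite subset of a group extends to a permutation. -/
theorem exists_perm_extend {G : Type} [Group G] (Z : Set G) (hZ : Z.Finite) (a : G) :
    ∃ σ : Equiv.Perm Z, ∀ z : Z, ∀ h : a * z ∈ Z, σ z = ⟨a * z, h⟩ := by
  classical
  have : Fintype Z := hZ.fintype
  let p : Z → Prop := fun z => a * z ∈ Z
  let q : Z → Prop := fun z => a⁻¹ * z ∈ Z
  let e : {z // p z} ≃ {z // q z} :=
    { toFun := fun z => ⟨⟨a * z.1, z.2⟩, by simp [q]⟩
      invFun := fun z => ⟨⟨a⁻¹ * z.1, z.2⟩, by simp [p]⟩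
      left_inv := fun z => by ext; simp
      right_inv := fun z => by ext; simp }
  refine ⟨e.extendSubtype, fun z h => ?_⟩
  rw [Equiv.extendSubtype_apply_of_mem e z h]
  rfl

theorem freeGroup_RF (α : Type) : ResiduallyFinite (FreeGroup α) := by
  classical
  intro g hg
  let Z : Set (FreeGroup α) := {z | ∃ L ∈ g.toWord.tails, z = FreeGroup.mk L}
  have hZ : Z.Finite := by
    have : Z = (fun L => FreeGroup.mk L) '' {L | L ∈ g.toWord.tails} := by
      ext z; simp only [Z, Set.mem_ofPred_eq, Set.mem_image]
      constructor
      · rintro ⟨L, h, rfl⟩; exact ⟨L, h, rfl⟩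
      · rintro ⟨L, h, rfl⟩; exact ⟨L, h, rfl⟩
    rw [this]
    exact (List.finite_toSet _).image _
  have : Finite Z := hZ
  choose σ hσ using fun a : α => exists_perm_extend Z hZ (FreeGroup.of a)
  let φ : FreeGroup α →* Equiv.Perm Z := FreeGroup.lift σ
  have h1 : (1 : FreeGroup α) ∈ Z := ⟨[], by simp, by simp [FreeGroup.one_eq_mk]⟩
  have key : ∀ L : List (α × Bool), L <:+ g.toWord →
      ∃ h : FreeGroup.mk L ∈ Z, φ (FreeGroup.mk L) ⟨1, h1⟩ = ⟨FreeGroup.mk L, h⟩ := by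
    intro L
    induction L with
    | nil => intro _; exact ⟨h1, by simp [← FreeGroup.one_eq_mk]⟩
    | cons x L ih =>
      intro hL
      have hL' : L <:+ g.toWord := (List.suffix_cons x L).trans hL
      obtain ⟨h, hh⟩ := ih hL'
      have hm : FreeGroup.mk (x :: L) ∈ Z := ⟨_, by simpa using hL, rfl⟩
      refine ⟨hm, ?_⟩
      have e : FreeGroup.mk (x :: L) = FreeGroup.mk [x] * FreeGroup.mk L := by
        rw [FreeGroup.mul_mk]; rfl
      have e2 : φ (FreeGroup.mk (x :: L)) ⟨1, h1⟩ = φ (FreeGroup.mk [x]) ⟨FreeGroup.mk L, h⟩ := by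
        rw [e, map_mul, Equiv.Perm.mul_apply, hh]
      rw [e2]
      obtain ⟨a, b⟩ := x
      cases b with
      | true =>
        have : φ (FreeGroup.mk [(a, true)]) = σ a := FreeGroup.lift_apply_of ..
        rw [this, hσ a ⟨_, h⟩ (by simpa [FreeGroup.of, FreeGroup.mul_mk] using hm)]
        ext; simp [FreeGroup.of, FreeGroup.mul_mk]
      | false =>
        have h3 : FreeGroup.mk [(a, false)] = (FreeGroup.of a)⁻¹ := by
          simp [FreeGroup.of, FreeGroup.inv_mk, FreeGroup.invRev]
        have : φ (FreeGroup.mk [(a, false)]) = (σ a)⁻¹ := by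
          rw [h3, map_inv]; simp [φ]
        rw [this, Equiv.Perm.inv_eq_iff_eq]
        have h4 : FreeGroup.of a * FreeGroup.mk ((a, false) :: L) = FreeGroup.mk L := by
          rw [e, h3]; simp
        rw [hσ a ⟨_, hm⟩ (by simpa [h4] using h)]
        ext; simp [h4]
  refine RF_of_perm g φ ?_
  intro hφ
  obtain ⟨h, hh⟩ := key g.toWord List.suffix_rfl
  have := congrArg Subtype.val hh
  apply hg
  simp only [FreeGroup.mk_toWord, hφ, Equiv.Perm.one_apply] at this
  exact this.symm

end RFArt

end

section

namespace RFArt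

/-- A free action of `H` on `X` is isomorphic to `H × O`. -/
theorem free_action_equiv {H X : Type} [Group H] (ρ : H →* Equiv.Perm X)
    (hfree : ∀ h x, ρ h x = x → h = 1) :
    ∃ (O : Type) (e : H × O ≃ X), ∀ h h' o, e (h * h', o) = ρ h (e (h', o)) := by
  classical
  let s : Setoid X :=
    { r := fun x y => ∃ h, ρ h x = y
      iseqv := ⟨fun x => ⟨1, by simp⟩, fun {x y} ⟨h, hh⟩ => ⟨h⁻¹, by simp [← hh]⟩,
        fun {x y z} ⟨h, hh⟩ ⟨k, hk⟩ => ⟨k * h, by simp [← hk, ← hh]⟩⟩ }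
  let f : H × Quotient s → X := fun a => ρ a.1 a.2.out
  have hf : Function.Bijective f := by
    constructor
    · rintro ⟨h, o⟩ ⟨h', o'⟩ hh
      have hh : ρ h o.out = ρ h' o'.out := hh
      have : o = o' := by
        rw [← o.out_eq, ← o'.out_eq]
        apply Quotient.sound
        exact ⟨h'⁻¹ * h, by simp [hh]⟩
      subst this
      have h2 : h'⁻¹ * h = 1 := hfree _ o.out (by simp [hh])
      have : h = h' := by rw [inv_mul_eq_one] at h2; exact h2.symm
      rw [this]
    · intro x
      obtain ⟨h, hh⟩ : s (Quotient.mk s x).out x := Quotient.mk_out x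
      exact ⟨(h, Quotient.mk s x), hh⟩
  refine ⟨Quotient s, Equiv.ofBijective f hf, fun h h' o => ?_⟩
  simp [f]

theorem free_action_extend {H K X : Type} [Group H] [Group K] [Finite K] [Finite X]
    (φ : H →* K) (hφ : Function.Injective φ) (ρ : H →* Equiv.Perm X)
    (hfree : ∀ h x, ρ h x = x → h = 1) (hdvd : Nat.card K ∣ Nat.card X) :
    ∃ σ : K →* Equiv.Perm X, ∀ h, σ (φ h) = ρ h := by
  classical
  have : Finite H := Finite.of_injective φ hφ
  obtain ⟨O, e, he⟩ := free_action_equiv ρ hfree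
  obtain ⟨m, hm⟩ := hdvd
  let X' := K × Fin m
  let τ : K →* Equiv.Perm X' := MonoidHom.toHomPerm
    { toFun := fun k x => (k * x.1, x.2)
      map_one' := by funext x; simp; rfl
      map_mul' := by intro a b; funext x; simp only [map_mul, mul_assoc]; rfl }
  have hτ : ∀ k x, τ k x = (k * x.1, x.2) := fun k x => rfl
  obtain ⟨O', e', he'⟩ := free_action_equiv (τ.comp φ) (fun h x hx => by
    apply hφ
    have := congrArg Prod.fst hx
    simpa [hτ] using this)
  have hcard : Nat.card X = Nat.card X' := by
    rw [hm]; simp [X', Nat.card_prod]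
  have hO : Finite O := by
    have : Finite (H × O) := Finite.of_equiv _ e.symm
    exact Finite.of_injective (fun o => ((1 : H), o)) (fun a b h => by simpa using h)
  have hO' : Finite O' := by
    have : Finite (H × O') := Finite.of_equiv _ e'.symm
    exact Finite.of_injective (fun o => ((1 : H), o)) (fun a b h => by simpa using h)
  have hc : Nat.card O = Nat.card O' := by
    have h1 := Nat.card_congr e
    have h2 := Nat.card_congr e'
    rw [Nat.card_prod] at h1 h2
    have : Nat.card H * Nat.card O = Nat.card H * Nat.card O' := by rw [h1, h2, hcard]
    exact Nat.eq_of_mul_eq_mul_left Nat.card_pos this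
  let eO : O ≃ O' := (Finite.equivFinOfCardEq hc).trans (Finite.equivFin O').symm
  let E : X ≃ X' := (e.symm.trans (Equiv.prodCongr (Equiv.refl H) eO)).trans e'
  have hE : ∀ h x, E (ρ h x) = τ (φ h) (E x) := by
    intro h x
    obtain ⟨⟨h', o⟩, rfl⟩ := e.surjective x
    rw [← he]
    simp only [E, Equiv.trans_apply, Equiv.symm_apply_apply, Equiv.prodCongr_apply, Prod.map,
      Equiv.refl_apply]
    rw [he']; rfl
  refine ⟨(E.symm.permCongrHom.toMonoidHom).comp τ, fun h => ?_⟩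
  ext x
  simp only [MonoidHom.comp_apply, MulEquiv.toMonoidHom_eq_coe, MonoidHom.coe_coe,
    Equiv.permCongrHom_coe, Equiv.permCongr_apply, Equiv.symm_symm]
  rw [← hE, Equiv.symm_apply_apply]

open Monoid in
theorem finite_amalgam_RF {ι : Type} [Finite ι] [Nonempty ι] {H : Type} {G : ι → Type}
    [Group H] [∀ i, Group (G i)] [∀ i, Finite (G i)] (φ : ∀ i, H →* G i)
    (hφ : ∀ i, Function.Injective (φ i)) : ResiduallyFinite (PushoutI φ) := by
  classical
  have := Fintype.ofFinite ι
  intro g hg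
  have hlist : ∀ g : PushoutI φ, ∃ L : List (Σ i, G i),
      g = (L.map fun x => PushoutI.of (φ := φ) x.1 x.2).prod := by
    intro g
    induction g using PushoutI.induction_on with
    | of i x => exact ⟨[⟨i, x⟩], by simp⟩
    | base h =>
      obtain ⟨i⟩ := (inferInstance : Nonempty ι)
      exact ⟨[⟨i, φ i h⟩], by simp [PushoutI.of_apply_eq_base]⟩
    | mul x y hx hy =>
      obtain ⟨L, rfl⟩ := hx
      obtain ⟨L', rfl⟩ := hy
      exact ⟨L ++ L', by simp⟩
  obtain ⟨L, hL⟩ := hlist g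
  let pr : List (Σ i, G i) → PushoutI φ := fun L =>
    (L.map fun x => PushoutI.of (φ := φ) x.1 x.2).prod
  let Z : Set (PushoutI φ) :=
    (fun x : List (Σ i, G i) × (Σ i, G i) => PushoutI.of (φ := φ) x.2.1 x.2.2 * pr x.1) ''
      ({L' | L' ∈ L.tails} ×ˢ Set.univ)
  have hZ : Z.Finite := by
    apply Set.Finite.image
    exact (List.finite_toSet _).prod Set.finite_univ
  have : Finite Z := hZ
  have hmem : ∀ L', L' <:+ L → ∀ i (k : G i), PushoutI.of (φ := φ) i k * pr L' ∈ Z := by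
    intro L' h i k
    exact ⟨(L', ⟨i, k⟩), ⟨by simpa using h, trivial⟩, rfl⟩
  have hmem1 : ∀ L', L' <:+ L → pr L' ∈ Z := by
    intro L' h
    obtain ⟨i⟩ := (inferInstance : Nonempty ι)
    simpa using hmem L' h i 1
  have hbase : ∀ h z, z ∈ Z → PushoutI.base φ h * z ∈ Z := by
    rintro h z ⟨⟨L', ⟨i, k⟩⟩, ⟨h1, -⟩, rfl⟩
    have := hmem L' (by simpa using h1) i (φ i h * k)
    rw [map_mul, PushoutI.of_apply_eq_base, mul_assoc] at this
    exact this
  let N : ℕ := ∏ i, Nat.card (G i)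
  have hN : 0 < N := Finset.prod_pos fun i _ => Nat.card_pos
  let Ω := Z × Fin N
  let β : H →* Equiv.Perm Ω := MonoidHom.toHomPerm
    { toFun := fun h x => (⟨PushoutI.base φ h * x.1, hbase h _ x.1.2⟩, x.2)
      map_one' := by funext x; simp; rfl
      map_mul' := by intro a b; funext x; simp only [map_mul, mul_assoc]; rfl }
  have hβ : ∀ h x, β h x = (⟨PushoutI.base φ h * x.1, hbase h _ x.1.2⟩, x.2) := fun _ _ => rfl
  have hσ : ∀ i, ∃ σ : G i →* Equiv.Perm Ω, (∀ h, σ (φ i h) = β h) ∧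
      ∀ (z : Ω) (_ : ∀ k, PushoutI.of (φ := φ) i k * z.1 ∈ Z) (k : G i),
        ((σ k z).1 : PushoutI φ) = PushoutI.of (φ := φ) i k * z.1 ∧ (σ k z).2 = z.2 := by
    intro i
    let p : Ω → Prop := fun z => ∀ k, PushoutI.of (φ := φ) i k * z.1 ∈ Z
    let A : G i →* Equiv.Perm {z // p z} := MonoidHom.toHomPerm
      { toFun := fun k x => ⟨(⟨PushoutI.of (φ := φ) i k * x.1.1, x.2 k⟩, x.1.2), fun k' => by
          have := x.2 (k' * k)
          simpa [mul_assoc] using this⟩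
        map_one' := by funext x; simp; rfl
        map_mul' := by intro a b; funext x; simp only [map_mul, mul_assoc]; rfl }
    have hpb : ∀ h (x : Ω), p (β h x) → p x := by
      intro h x hp k
      have := hp (k * (φ i h)⁻¹)
      rw [← map_inv, map_mul, PushoutI.of_apply_eq_base, hβ] at this
      simpa [mul_assoc] using this
    let B : H →* Equiv.Perm {z // ¬ p z} := MonoidHom.toHomPerm
      { toFun := fun h x => ⟨β h x.1, fun hp => x.2 (hpb h x.1 hp)⟩
        map_one' := by funext x; simp; rfl
        map_mul' := by intro a b; funext x; simp only [map_mul]; rfl }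
    let bad : Z → Prop := fun z => ¬ ∀ k, PushoutI.of (φ := φ) i k * z ∈ Z
    have hcard : Nat.card (G i) ∣ Nat.card {z // ¬ p z} := by
      let e : {z // ¬ p z} ≃ {z // bad z} × Fin N :=
        { toFun := fun x => (⟨x.1.1, x.2⟩, x.1.2)
          invFun := fun x => ⟨(x.1.1, x.2), x.1.2⟩
          left_inv := fun x => rfl
          right_inv := fun x => rfl }
      rw [Nat.card_congr e, Nat.card_prod, Nat.card_fin]
      exact Dvd.dvd.mul_left (Finset.dvd_prod_of_mem _ (Finset.mem_univ i)) _
    obtain ⟨B', hB'⟩ := free_action_extend (φ i) (hφ i) B (by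
      intro h x hx
      have h1 : β h x.1 = x.1 := congrArg Subtype.val hx
      have h2 : PushoutI.base φ h * x.1.1 = x.1.1 := congrArg (fun y => (y.1 : PushoutI φ)) h1
      exact PushoutI.base_injective hφ (by simpa using h2)) hcard
    refine ⟨(Equiv.Perm.subtypeCongrHom p).comp (A.prod B'), ?_, ?_⟩
    · intro h
      ext1 x
      by_cases hx : p x
      · simp only [MonoidHom.comp_apply, Equiv.Perm.subtypeCongrHom_apply, MonoidHom.prod_apply]
        rw [Equiv.Perm.subtypeCongr.left_apply _ _ hx, hβ]
        change ((⟨PushoutI.of (φ := φ) i (φ i h) * x.1, _⟩, x.2) : Ω) = _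
        simp [PushoutI.of_apply_eq_base]
      · simp only [MonoidHom.comp_apply, Equiv.Perm.subtypeCongrHom_apply, MonoidHom.prod_apply]
        rw [Equiv.Perm.subtypeCongr.right_apply _ _ hx, hB']
        rfl
    · intro z hz k
      simp only [MonoidHom.comp_apply, Equiv.Perm.subtypeCongrHom_apply, MonoidHom.prod_apply]
      rw [Equiv.Perm.subtypeCongr.left_apply _ _ (show p z from hz)]
      exact ⟨rfl, rfl⟩
  choose σ hσ1 hσ2 using hσ
  let Φ : PushoutI φ →* Equiv.Perm Ω := PushoutI.lift σ β (fun i => by ext1 h; exact hσ1 i h)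
  have h1 : (1 : PushoutI φ) ∈ Z := by simpa [pr] using hmem1 [] (by simp)
  let z0 : Ω := (⟨1, h1⟩, ⟨0, hN⟩)
  have key : ∀ L', L' <:+ L → ((Φ (pr L') z0).1 : PushoutI φ) = pr L' := by
    intro L'
    induction L' with
    | nil => intro _; simp [pr, z0]
    | cons x L' ih =>
      intro h
      have h' : L' <:+ L := (List.suffix_cons x L').trans h
      have e : pr (x :: L') = PushoutI.of (φ := φ) x.1 x.2 * pr L' := by simp [pr]
      rw [e, map_mul, Equiv.Perm.mul_apply]
      have e2 : Φ (PushoutI.of x.1 x.2) = σ x.1 x.2 := by simp [Φ]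
      rw [e2, (hσ2 x.1 _ (fun k => by rw [ih h']; exact hmem L' h' _ k) x.2).1, ih h']
  refine RF_of_perm g Φ fun h => hg ?_
  have := key L List.suffix_rfl
  have e : pr L = g := hL.symm
  rw [e, h] at this
  exact this.symm

end RFArt

end

section

namespace RFArt

open Monoid in
theorem amalgam_sep {ι : Type} [Finite ι] [Nonempty ι] {H : Type} {G : ι → Type}
    [Group H] [∀ i, Group (G i)] (φ : ∀ i, H →* G i)
    (N0 : Subgroup H) [N0.Normal] (N : ∀ i, Subgroup (G i)) [∀ i, (N i).Normal]
    [∀ i, (N i).FiniteIndex] (hcomap : ∀ i, (N i).comap (φ i) = N0)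
    (h : H) (w : CoprodI.Word G)
    (hw : ∀ x ∈ w.toList, ∀ h', φ x.1 h' * x.2 ∉ N x.1)
    (hne : w.toList = [] → h ∉ N0) :
    ∃ (Q : Type) (_ : Group Q) (_ : Finite Q) (ψ : PushoutI φ →* Q),
      ψ (PushoutI.base φ h * PushoutI.ofCoprodI w.prod) ≠ 1 := by
  classical
  let φ' : ∀ i, H ⧸ N0 →* G i ⧸ N i := fun i =>
    QuotientGroup.map N0 (N i) (φ i) (hcomap i).ge
  have hφ' : ∀ i, Function.Injective (φ' i) := by
    intro i
    rw [injective_iff_map_eq_one]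
    intro a
    induction a using QuotientGroup.induction_on with
    | H a =>
      intro ha
      simp only [φ', QuotientGroup.map_mk, QuotientGroup.eq_one_iff] at ha
      rw [QuotientGroup.eq_one_iff, ← hcomap i]
      exact ha
  have hfin : ∀ i, Finite (G i ⧸ N i) := fun i => inferInstance
  let π : PushoutI φ →* PushoutI φ' := PushoutI.lift
    (fun i => (PushoutI.of i).comp (QuotientGroup.mk' (N i)))
    ((PushoutI.base φ').comp (QuotientGroup.mk' N0)) (by
      intro i
      ext a
      simp only [MonoidHom.comp_apply, QuotientGroup.mk'_apply]
      rw [← PushoutI.of_apply_eq_base φ' i]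
      rfl)
  have hgood : ∀ x ∈ w.toList, (QuotientGroup.mk' (N x.1) x.2) ∉ (φ' x.1).range := by
    rintro x hx ⟨a, ha⟩
    induction a using QuotientGroup.induction_on with
    | H a =>
      simp only [φ', QuotientGroup.map_mk, QuotientGroup.mk'_apply] at ha
      rw [QuotientGroup.eq] at ha
      exact hw x hx a⁻¹ (by simpa using ha)
  let w' : CoprodI.Word (fun i => G i ⧸ N i) :=
    { toList := w.toList.map fun x => ⟨x.1, QuotientGroup.mk' (N x.1) x.2⟩
      ne_one := by
        intro l hl
        obtain ⟨x, hx, rfl⟩ := List.mem_map.mp hl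
        intro h1
        exact hgood x hx ⟨1, by rw [map_one]; exact h1.symm⟩
      chain_ne := by
        rw [List.isChain_map]
        exact w.chain_ne }
  have hred : PushoutI.Reduced φ' w' := by
    intro l hl
    obtain ⟨x, hx, rfl⟩ := List.mem_map.mp hl
    exact hgood x hx
  have hπ : π (PushoutI.base φ h * PushoutI.ofCoprodI w.prod) =
      PushoutI.base φ' (QuotientGroup.mk' N0 h) * PushoutI.ofCoprodI w'.prod := by
    rw [map_mul]
    congr 1
    simp only [CoprodI.Word.prod, w', map_list_prod, List.map_map]
    refine congrArg List.prod (List.map_congr_left ?_)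
    intro x hx
    simp [π]
  have hπ1 : π (PushoutI.base φ h * PushoutI.ofCoprodI w.prod) ≠ 1 := by
    rw [hπ]
    intro h1
    have h2 : PushoutI.ofCoprodI w'.prod ∈ (PushoutI.base φ').range := by
      rw [← inv_eq_iff_mul_eq_one] at h1
      exact ⟨(QuotientGroup.mk' N0 h)⁻¹, by rw [map_inv]; exact h1⟩
    have h3 := hred.eq_empty_of_mem_range hφ' h2
    have h4 : w.toList = [] := by
      have : w'.toList = [] := by rw [h3]; rfl
      simpa [w'] using this
    apply hne h4
    rw [h3] at h1
    simp only [CoprodI.Word.prod_empty, map_one, mul_one] at h1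
    rw [← QuotientGroup.eq_one_iff]
    exact PushoutI.base_injective hφ' (by simpa using h1)
  obtain ⟨Q, i1, i2, ψ, hψ⟩ := finite_amalgam_RF φ' hφ' _ hπ1
  exact ⟨Q, i1, i2, ψ.comp π, hψ⟩

/-- The verbal-type subgroup: intersection of kernels of all homs to `R`. -/
def VR (R H : Type) [Group R] [Group H] : Subgroup H := ⨅ f : H →* R, f.ker

theorem mem_VR {R H : Type} [Group R] [Group H] {h : H} :
    h ∈ VR R H ↔ ∀ f : H →* R, f h = 1 := by
  simp [VR, Subgroup.mem_iInf, MonoidHom.mem_ker]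

theorem VR_map {R H K : Type} [Group R] [Group H] [Group K] (f : H →* K) {h : H}
    (hh : h ∈ VR R H) : f h ∈ VR R K := by
  rw [mem_VR] at *
  intro g
  exact hh (g.comp f)

instance VR_char (R H : Type) [Group R] [Group H] : (VR R H).Characteristic := by
  rw [Subgroup.characteristic_iff_le_comap]
  intro e h hh
  exact VR_map e.toMonoidHom hh

theorem VR_prod_left {R R' H : Type} [Group R] [Group R'] [Group H] {h : H}
    (hh : h ∈ VR (R × R') H) : h ∈ VR R H := by
  rw [mem_VR] at *
  intro f
  have := hh (f.prod 1)
  simpa using this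

theorem VR_prod_right {R R' H : Type} [Group R] [Group R'] [Group H] {h : H}
    (hh : h ∈ VR (R × R') H) : h ∈ VR R' H := by
  rw [mem_VR] at *
  intro f
  have := hh ((1 : H →* R).prod f)
  simpa using this

instance VR_finiteIndex (R H : Type) [Group R] [Group H] [Finite R] [Group.FG H] :
    (VR R H).FiniteIndex := by
  obtain ⟨S, hS⟩ := (Group.fg_iff' (G := H)).mp inferInstance |>.imp fun n h => h
  obtain ⟨S, hS1, hS2⟩ := hS
  have : Finite (H →* R) := by
    apply Finite.of_injective (fun f : H →* R => fun s : S => f s)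
    intro f g hfg
    apply MonoidHom.eq_of_eqOn_dense hS2
    intro x hx
    exact congrFun hfg ⟨x, hx⟩
  unfold VR
  exact Subgroup.finiteIndex_iInf fun f => Subgroup.finiteIndex_ker f

open Monoid in
theorem amalgam_RF {ι : Type} [Finite ι] [Nonempty ι] {H : Type} {G : ι → Type}
    [Group H] [∀ i, Group (G i)] (φ : ∀ i, H →* G i)
    (hFG : ∀ i, Group.FG (G i)) (hRF : ∀ i, ResiduallyFinite (G i))
    (K : ∀ i, Subgroup (G i)) (hKn : ∀ i, (K i).Normal) (hKf : ∀ i, (K i).FiniteIndex)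
    (hK : ∀ i h, φ i h ∈ K i) (ρ : ∀ i, K i →* H)
    (hρ : ∀ i h, ρ i ⟨φ i h, hK i h⟩ = h) : ResiduallyFinite (PushoutI φ) := by
  classical
  have hφ : ∀ i, Function.Injective (φ i) := by
    intro i a b hab
    rw [← hρ i a, ← hρ i b]
    simp [hab]
  let φ' : ∀ i, H →* K i := fun i => (φ i).codRestrict (K i) (hK i)
  have hφ' : ∀ i h, φ' i h = ⟨φ i h, hK i h⟩ := fun _ _ => rfl
  have hKFG : ∀ i, Group.FG (K i) := fun i => inferInstance
  let N : ∀ (R : Type) [Group R] (i : ι), Subgroup (G i) :=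
    fun R _ i => (VR R (K i)).map (K i).subtype
  have hNn : ∀ (R : Type) [Group R] (i : ι), (N R i).Normal := fun R _ i =>
    ConjAct.normal_of_characteristic_of_normal
  have hNf : ∀ (R : Type) [Group R] [Finite R] (i : ι), (N R i).FiniteIndex := by
    intro R _ _ i
    constructor
    simp only [N, Subgroup.index_map_subtype]
    exact mul_ne_zero (VR_finiteIndex R (K i)).index_ne_zero (hKf i).index_ne_zero
  have hmemN : ∀ (R : Type) [Group R] (i : ι) (g : G i),
      g ∈ N R i ↔ ∃ hg : g ∈ K i, (⟨g, hg⟩ : K i) ∈ VR R (K i) := by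
    intro R _ i g
    simp only [N, Subgroup.mem_map]
    constructor
    · rintro ⟨x, hx, rfl⟩
      exact ⟨x.2, hx⟩
    · rintro ⟨hg, h⟩
      exact ⟨_, h, rfl⟩
  have hcomap : ∀ (R : Type) [Group R] (i : ι), (N R i).comap (φ i) = VR R H := by
    intro R _ i
    ext h
    rw [Subgroup.mem_comap, hmemN]
    constructor
    · rintro ⟨hg, h1⟩
      have := VR_map (ρ i) h1
      rwa [hρ] at this
    · intro h1
      exact ⟨hK i h, VR_map (φ' i) h1⟩
  have hgood : ∀ i (g : G i), g ∉ (φ i).range → ∃ (R : Type) (_ : Group R) (_ : Finite R),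
      ∀ h, φ i h * g ∉ N R i := by
    intro i g hg
    by_cases hgK : g ∈ K i
    · let k : K i := (φ' i (ρ i ⟨g, hgK⟩))⁻¹ * ⟨g, hgK⟩
      have hk : k ≠ 1 := by
        intro h1
        rw [inv_mul_eq_one] at h1
        exact hg ⟨_, congrArg Subtype.val h1⟩
      obtain ⟨R, i1, i2, f, hf⟩ := hRF i k (by simpa using hk)
      refine ⟨R, i1, i2, fun h hh => ?_⟩
      rw [hmemN] at hh
      obtain ⟨h1, h2⟩ := hh
      have e1 : (⟨φ i h * g, h1⟩ : K i) = φ' i h * ⟨g, hgK⟩ := rfl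
      rw [e1] at h2
      have h3 := VR_map (φ' i) (VR_map (ρ i) h2)
      rw [map_mul, show ρ i (φ' i h) = h from hρ i h] at h3
      have h4 := mul_mem (inv_mem h3) h2
      have e2 : (φ' i (h * ρ i ⟨g, hgK⟩))⁻¹ * (φ' i h * ⟨g, hgK⟩) = k := by
        simp only [k, map_mul]; group
      rw [e2, mem_VR] at h4
      exact hf (h4 (f.comp (K i).subtype))
    · refine ⟨Unit, inferInstance, inferInstance, fun h hh => hgK ?_⟩
      rw [hmemN] at hh
      exact ((K i).mul_mem_cancel_left (hK i h)).mp hh.1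
  have hgoods : ∀ L : List (Σ i, G i), (∀ x ∈ L, x.2 ∉ (φ x.1).range) →
      ∃ (R : Type) (_ : Group R) (_ : Finite R), ∀ x ∈ L, ∀ h, φ x.1 h * x.2 ∉ N R x.1 := by
    intro L
    induction L with
    | nil => intro _; exact ⟨Unit, inferInstance, inferInstance, by simp⟩
    | cons x L ih =>
      intro hL
      obtain ⟨R, i1, i2, hR⟩ := ih fun y hy => hL y (List.mem_cons_of_mem _ hy)
      obtain ⟨R', i1', i2', hR'⟩ := hgood x.1 x.2 (hL x List.mem_cons_self)
      refine ⟨R × R', inferInstance, inferInstance, ?_⟩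
      intro y hy h hh
      rw [hmemN] at hh
      obtain ⟨h1, h2⟩ := hh
      rcases List.mem_cons.mp hy with rfl | hy
      · exact hR' h ((hmemN _ _ _).mpr ⟨h1, VR_prod_right h2⟩)
      · exact hR y hy h ((hmemN _ _ _).mpr ⟨h1, VR_prod_left h2⟩)
  intro g hg
  obtain ⟨d⟩ := PushoutI.NormalWord.transversal_nonempty φ hφ
  let w := PushoutI.NormalWord.equiv (d := d) g
  have hgw : g = PushoutI.base φ w.head * PushoutI.ofCoprodI w.toWord.prod := by
    have := PushoutI.NormalWord.equiv (d := d) |>.symm_apply_apply g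
    exact this.symm
  have hwr : ∀ x ∈ w.toWord.toList, x.2 ∉ (φ x.1).range := by
    rintro x hx hr
    have hd := w.normalized x.1 x.2 hx
    apply w.toWord.ne_one x hx
    have hc := (d.compl x.1).1
    have := @hc (⟨x.2, hr⟩, ⟨1, d.one_mem x.1⟩) (⟨1, one_mem _⟩, ⟨x.2, hd⟩) (by simp)
    have := congrArg (fun y => (y.2 : G x.1)) this
    exact this.symm
  obtain ⟨R, i1, i2, hR⟩ := hgoods _ hwr
  by_cases hemp : w.toWord.toList = []
  · have hh : w.head ≠ 1 := by
      intro h1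
      apply hg
      have : w.toWord = CoprodI.Word.empty := by ext1; exact hemp
      rw [hgw, h1, this]; simp
    obtain ⟨i⟩ := (inferInstance : Nonempty ι)
    obtain ⟨R', i1', i2', f, hf⟩ := hRF i (φ i w.head) (fun h => hh (hφ i (by simpa using h)))
    have := amalgam_sep φ (VR R' H) (N R') (hcomap R') w.head w.toWord
      (by rw [hemp]; simp) (fun _ h => hf (mem_VR.mp h (f.comp (φ i))))
    rwa [← hgw] at this
  · have := amalgam_sep φ (VR R H) (N R) (hcomap R) w.head w.toWord hR (fun h => absurd h hemp)
    rwa [← hgw] at this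

end RFArt

end

section

namespace RFArt

theorem mat_pow {F : Type} [Field F] (M : Matrix (Fin 2) (Fin 2) F) (e1 e2 : F)
    (he : e1 ≠ e2) (htr : M 0 0 + M 1 1 = e1 + e2) (hdet : M 0 0 * M 1 1 - M 0 1 * M 1 0 = e1 * e2)
    (i : ℕ) : ∃ α : F, α * (e1 - e2) = e1 ^ i - e2 ^ i ∧
      M ^ i = α • M + (e1 ^ i - α * e1) • (1 : Matrix (Fin 2) (Fin 2) F) := by
  have hsq : M * M = (e1 + e2) • M - (e1 * e2) • (1 : Matrix (Fin 2) (Fin 2) F) := by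
    ext a b
    fin_cases a <;> fin_cases b <;>
      simp [Matrix.mul_apply, Fin.sum_univ_two] <;> rw [← htr]
    · rw [← hdet]; ring
    · ring
    · ring
    · rw [← hdet]; ring
  induction i with
  | zero => exact ⟨0, by simp, by simp⟩
  | succ i ih =>
    obtain ⟨α, h1, h2⟩ := ih
    refine ⟨α * e2 + e1 ^ i, by rw [pow_succ, pow_succ]; linear_combination e2 * h1, ?_⟩
    rw [pow_succ, h2, add_mul, smul_mul_assoc, smul_mul_assoc, hsq, one_mul]
    ext a b
    simp only [Matrix.add_apply, Matrix.smul_apply, Matrix.sub_apply, smul_eq_mul]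
    ring

theorem exists_order (n : ℕ) (hn : n ≠ 0) : ∃ (p : ℕ) (_ : Fact p.Prime) (g : (ZMod p)ˣ),
    orderOf g = n := by
  obtain ⟨p, hp, -, h⟩ := Nat.exists_prime_gt_modEq_one (k := n) 1 hn
  have : Fact p.Prime := ⟨hp⟩
  refine ⟨p, this, ?_⟩
  obtain ⟨u, hu⟩ := IsCyclic.exists_ofOrder_eq_natCard (α := (ZMod p)ˣ)
  have hc : Nat.card (ZMod p)ˣ = p - 1 := by
    rw [Nat.card_eq_fintype_card, ZMod.card_units]
  have hd : n ∣ p - 1 := (Nat.modEq_iff_dvd' hp.one_lt.le).mp h.symm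
  obtain ⟨c, hcc⟩ := hd
  have hp1 : 0 < p - 1 := Nat.sub_pos_of_lt hp.one_lt
  have hc0 : c ≠ 0 := by rintro rfl; omega
  refine ⟨u ^ c, ?_⟩
  rw [orderOf_pow_of_dvd hc0 (by rw [hu, hc, hcc]; exact dvd_mul_left _ _), hu, hc, hcc]
  exact Nat.mul_div_cancel _ (Nat.pos_of_ne_zero hc0)

/-- Existence of finite quotients of triangle groups with exact orders. -/
theorem exists_triangle (k l m : ℕ) (hk : 2 ≤ k) (hl : 2 ≤ l) (hm : 2 ≤ m) :
    ∃ (T : Type) (_ : Group T) (_ : Finite T) (x y z : T), x * z * y = 1 ∧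
      orderOf x = k ∧ orderOf y = l ∧ orderOf z = m ∧
      (∀ i : ℕ, x ^ i ≠ y) ∧ (∀ i : ℕ, y ^ i ≠ x) ∧ (∀ i : ℕ, z ^ i ≠ x) := by
  classical
  obtain ⟨p, _, g, hg⟩ := exists_order (2 * k * l * m) (by positivity)
  let F := ZMod p
  let ζu : Fˣ := g ^ (2 * l * m)
  let ηu : Fˣ := g ^ (2 * k * m)
  let ξu : Fˣ := g ^ (2 * k * l)
  let lamu : Fˣ := g ^ (l * m + k * m) * (g ^ (k * l))⁻¹
  have oζ : orderOf ζu = k := by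
    rw [orderOf_pow_of_dvd (by positivity) (by rw [hg]; exact ⟨k, by ring⟩), hg]
    exact Nat.div_eq_of_eq_mul_left (by positivity) (by ring)
  have oη : orderOf ηu = l := by
    rw [orderOf_pow_of_dvd (by positivity) (by rw [hg]; exact ⟨l, by ring⟩), hg]
    exact Nat.div_eq_of_eq_mul_left (by positivity) (by ring)
  have oξ : orderOf ξu = m := by
    rw [orderOf_pow_of_dvd (by positivity) (by rw [hg]; exact ⟨m, by ring⟩), hg]
    exact Nat.div_eq_of_eq_mul_left (by positivity) (by ring)
  have hlamu : lamu ^ 2 * ξu = ζu * ηu := by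
    simp only [lamu, ξu, ζu, ηu]
    rw [mul_pow, inv_pow, ← pow_mul, ← pow_mul, mul_assoc, ← pow_add,
      show (k * l * 2 : ℕ) = 2 * k * l by ring, inv_mul_cancel, mul_one]
    congr 1; ring
  let ζ : F := ζu
  let η : F := ηu
  let ξ : F := ξu
  let lam : F := lamu
  have hζ0 : ζ ≠ 0 := ζu.ne_zero
  have hη0 : η ≠ 0 := ηu.ne_zero
  have hlam0 : lam ≠ 0 := lamu.ne_zero
  have hlam : lam ^ 2 * ξ = ζ * η := by
    have := congrArg Units.val hlamu
    simpa using this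
  have pζ : ∀ i, ζ ^ i = 1 ↔ k ∣ i := fun i => by
    rw [← oζ, orderOf_dvd_iff_pow_eq_one, Units.ext_iff]; simp [ζ]
  have pη : ∀ i, η ^ i = 1 ↔ l ∣ i := fun i => by
    rw [← oη, orderOf_dvd_iff_pow_eq_one, Units.ext_iff]; simp [η]
  have pξ : ∀ i, ξ ^ i = 1 ↔ m ∣ i := fun i => by
    rw [← oξ, orderOf_dvd_iff_pow_eq_one, Units.ext_iff]; simp [ξ]
  have hζ1 : ζ ≠ 1 := fun h => by
    have := (pζ 1).mp (by simpa using h); have := Nat.le_of_dvd one_pos this; omega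
  have hη1 : η ≠ 1 := fun h => by
    have := (pη 1).mp (by simpa using h); have := Nat.le_of_dvd one_pos this; omega
  have hξ1 : ξ ≠ 1 := fun h => by
    have := (pξ 1).mp (by simpa using h); have := Nat.le_of_dvd one_pos this; omega
  let s : F := (lam * (1 + ξ) - 1 - η) / (ζ - 1)
  have hs : ζ * s + 1 + η - s = lam * (1 + ξ) := by
    have : ζ - 1 ≠ 0 := sub_ne_zero.mpr hζ1
    have h2 : s * (ζ - 1) = lam * (1 + ξ) - 1 - η := div_mul_cancel₀ _ this
    linear_combination h2
  let w : F := s * (1 + η - s) - η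
  let X : GL (Fin 2) F := Matrix.GeneralLinearGroup.mkOfDetNeZero !![ζ, 0; 0, 1]
    (by simpa [Matrix.det_fin_two] using hζ0)
  let Y : GL (Fin 2) F := Matrix.GeneralLinearGroup.mkOfDetNeZero !![s, 1; w, 1 + η - s]
    (by simpa [Matrix.det_fin_two, w] using hη0)
  have hX : (X : Matrix (Fin 2) (Fin 2) F) = !![ζ, 0; 0, 1] := rfl
  have hY : (Y : Matrix (Fin 2) (Fin 2) F) = !![s, 1; w, 1 + η - s] := rfl
  have hW : ((Y * X : GL (Fin 2) F) : Matrix (Fin 2) (Fin 2) F) =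
      !![s * ζ, 1; w * ζ, 1 + η - s] := by
    rw [Matrix.GeneralLinearGroup.coe_mul, hX, hY]
    ext a b
    fin_cases a <;> fin_cases b <;> simp [Matrix.mul_apply, Fin.sum_univ_two]
  have hXp : ∀ i : ℕ, ((X ^ i : GL (Fin 2) F) : Matrix (Fin 2) (Fin 2) F) = !![ζ ^ i, 0; 0, 1] := by
    intro i
    induction i with
    | zero => ext a b; fin_cases a <;> fin_cases b <;> simp
    | succ i ih =>
      rw [pow_succ, Matrix.GeneralLinearGroup.coe_mul, ih, hX]
      ext a b
      fin_cases a <;> fin_cases b <;> simp [Matrix.mul_apply, Fin.sum_univ_two, pow_succ]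
  let Z := Subgroup.center (GL (Fin 2) F)
  -- central elements are scalar
  have hcen : ∀ C ∈ Z, ∃ c : F, c ≠ 0 ∧ (C : Matrix (Fin 2) (Fin 2) F) = c • 1 := by
    intro C hC
    have h1 := Subgroup.mem_center_iff.mp hC X
    have h2 := Subgroup.mem_center_iff.mp hC Y
    have e1 := congrArg (fun A : GL (Fin 2) F => (A : Matrix (Fin 2) (Fin 2) F) 0 1) h1
    have e2 := congrArg (fun A : GL (Fin 2) F => (A : Matrix (Fin 2) (Fin 2) F) 1 0) h1
    have e3 := congrArg (fun A : GL (Fin 2) F => (A : Matrix (Fin 2) (Fin 2) F) 0 1) h2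
    simp only [Matrix.GeneralLinearGroup.coe_mul, hX, hY, Matrix.mul_apply, Fin.sum_univ_two,
      Matrix.of_apply, Matrix.cons_val_zero, Matrix.cons_val_one, Matrix.cons_val',
      Matrix.cons_val_fin_one, zero_mul, mul_zero, add_zero, zero_add, mul_one, one_mul]
      at e1 e2 e3
    have hsub : ζ - 1 ≠ 0 := sub_ne_zero.mpr hζ1
    have f1 : (C : Matrix (Fin 2) (Fin 2) F) 0 1 = 0 := by
      have : (ζ - 1) * (C : Matrix (Fin 2) (Fin 2) F) 0 1 = 0 := by linear_combination e1
      simpa [hsub] using this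
    have f2 : (C : Matrix (Fin 2) (Fin 2) F) 1 0 = 0 := by
      have : (ζ - 1) * (C : Matrix (Fin 2) (Fin 2) F) 1 0 = 0 := by linear_combination -e2
      simpa [hsub] using this
    rw [f1] at e3
    have hCe : (C : Matrix (Fin 2) (Fin 2) F) =
        ((C : Matrix (Fin 2) (Fin 2) F) 0 0) • (1 : Matrix (Fin 2) (Fin 2) F) := by
      ext a b
      fin_cases a <;> fin_cases b <;> simp [f1, f2]
      linear_combination e3
    refine ⟨_, ?_, hCe⟩
    intro h0
    rw [h0, zero_smul] at hCe
    exact C.ne_zero hCe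
  have hcen' : ∀ (C : GL (Fin 2) F) (c : F), (C : Matrix (Fin 2) (Fin 2) F) = c • 1 → C ∈ Z := by
    intro C c h
    rw [Subgroup.mem_center_iff]
    intro A
    ext1
    rw [Matrix.GeneralLinearGroup.coe_mul, Matrix.GeneralLinearGroup.coe_mul, h]
    simp
  -- powers of `M` with upper right entry 1
  have hpowM : ∀ (A : GL (Fin 2) F) (e1 e2 : F), e1 ≠ e2 →
      (A : Matrix (Fin 2) (Fin 2) F) 0 0 + (A : Matrix (Fin 2) (Fin 2) F) 1 1 = e1 + e2 →
      (A : Matrix (Fin 2) (Fin 2) F) 0 0 * (A : Matrix (Fin 2) (Fin 2) F) 1 1 -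
        (A : Matrix (Fin 2) (Fin 2) F) 0 1 * (A : Matrix (Fin 2) (Fin 2) F) 1 0 = e1 * e2 →
      (A : Matrix (Fin 2) (Fin 2) F) 0 1 = 1 → ∀ i : ℕ,
      (e1 ^ i = e2 ^ i → A ^ i ∈ Z) ∧
      (((A ^ i : GL (Fin 2) F) : Matrix (Fin 2) (Fin 2) F) 0 1 = 0 →
        e1 ^ i = e2 ^ i ∧ A ^ i ∈ Z) := by
    intro A e1 e2 he htr hdet h01 i
    obtain ⟨α, h1, h2⟩ := mat_pow (A : Matrix (Fin 2) (Fin 2) F) e1 e2 he htr hdet i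
    have P1 : e1 ^ i = e2 ^ i → A ^ i ∈ Z := by
      intro h
      have hα : α = 0 := by
        rw [h, sub_self] at h1
        simpa [sub_ne_zero.mpr he] using h1
      apply hcen' _ (e1 ^ i)
      rw [Units.val_pow_eq_pow_val, h2, hα]; simp
    refine ⟨P1, fun h => ?_⟩
    rw [Units.val_pow_eq_pow_val, h2] at h
    simp [h01] at h
    rw [h, zero_mul] at h1
    have := (sub_eq_zero.mp h1.symm)
    exact ⟨this, P1 this⟩
  have hpY := hpowM Y η 1 hη1 (by simp [hY]; ring) (by simp [hY, w]) (by simp [hY])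
  have hlx : lam * ξ ≠ lam := fun h => hξ1 (mul_left_cancel₀ hlam0 (by rw [h, mul_one]))
  have hpW := hpowM (Y * X) (lam * ξ) lam hlx
    (by rw [hW]; simp; linear_combination hs)
    (by rw [hW]; simp [w]; linear_combination -hlam) (by rw [hW]; simp)
  let q := QuotientGroup.mk' Z
  have hq1 : ∀ A, q A = 1 ↔ A ∈ Z := fun A => QuotientGroup.eq_one_iff A
  have hq2 : ∀ A B, q A = q B → ∃ c : F, c ≠ 0 ∧ (B : Matrix (Fin 2) (Fin 2) F) = c • A := by
    intro A B h
    have : A⁻¹ * B ∈ Z := QuotientGroup.eq.mp h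
    obtain ⟨c, hc, h2⟩ := hcen _ this
    refine ⟨c, hc, ?_⟩
    have : B = A * (A⁻¹ * B) := by group
    rw [this, Matrix.GeneralLinearGroup.coe_mul, h2]; simp
  have hXc : X ∉ Z := by
    intro h
    obtain ⟨c, hc, h2⟩ := hcen _ h
    have e1 := congrFun (congrFun h2 0) 0
    have e2 := congrFun (congrFun h2 1) 1
    simp [hX] at e1 e2
    exact hζ1 (by rw [e1, ← e2])
  refine ⟨GL (Fin 2) F ⧸ Z, inferInstance, inferInstance, q X, q Y, (q (Y * X))⁻¹, ?_, ?_, ?_, ?_,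
    ?_, ?_, ?_⟩
  · rw [map_mul]; group
  · apply Nat.dvd_antisymm
    · rw [orderOf_dvd_iff_pow_eq_one, ← map_pow, hq1]
      apply hcen' _ 1
      rw [hXp, (pζ k).mpr dvd_rfl]
      ext a b; fin_cases a <;> fin_cases b <;> simp
    · rw [← pζ]
      have := pow_orderOf_eq_one (q X)
      rw [← map_pow, hq1] at this
      obtain ⟨c, hc, h2⟩ := hcen _ this
      rw [hXp] at h2
      have e1 := congrFun (congrFun h2 0) 0
      have e2 := congrFun (congrFun h2 1) 1
      simp at e1 e2
      rw [e1, ← e2]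
  · apply Nat.dvd_antisymm
    · rw [orderOf_dvd_iff_pow_eq_one, ← map_pow, hq1]
      exact (hpY l).1 (by rw [(pη l).mpr dvd_rfl, one_pow])
    · rw [← pη]
      have := pow_orderOf_eq_one (q Y)
      rw [← map_pow, hq1] at this
      obtain ⟨c, hc, h2⟩ := hcen _ this
      rw [((hpY _).2 (by rw [h2]; simp)).1, one_pow]
  · rw [orderOf_inv]
    apply Nat.dvd_antisymm
    · rw [orderOf_dvd_iff_pow_eq_one, ← map_pow, hq1]
      exact (hpW m).1 (by rw [mul_pow, (pξ m).mpr dvd_rfl, mul_one])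
    · rw [← pξ]
      have := pow_orderOf_eq_one (q (Y * X))
      rw [← map_pow, hq1] at this
      obtain ⟨c, hc, h2⟩ := hcen _ this
      have h3 := ((hpW _).2 (by rw [h2]; simp)).1
      rw [mul_pow] at h3
      exact mul_left_cancel₀ (pow_ne_zero _ hlam0) (by rw [h3, mul_one])
  · intro i h
    rw [← map_pow] at h
    obtain ⟨c, hc, h2⟩ := hq2 _ _ h
    have e := congrFun (congrFun h2 0) 1
    rw [hXp, hY] at e
    simp at e
  · intro i h
    rw [← map_pow] at h
    obtain ⟨c, hc, h2⟩ := hq2 _ _ h.symm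
    have h3 := ((hpY i).2 (by rw [h2, hX]; simp)).2
    rw [(hq1 _).mpr h3] at h
    exact hXc ((hq1 _).mp h.symm)
  · intro i h
    have h' : q ((Y * X) ^ i) = q X⁻¹ := by
      rw [map_pow, map_inv, ← h, inv_pow, inv_inv]
    have hXi : ((X⁻¹ : GL (Fin 2) F) : Matrix (Fin 2) (Fin 2) F) 0 1 = 0 := by
      have e := congrArg (fun A : GL (Fin 2) F => (A : Matrix (Fin 2) (Fin 2) F) 0 1)
        (inv_mul_cancel X)
      have e' := congrArg (fun A : GL (Fin 2) F => (A : Matrix (Fin 2) (Fin 2) F) 0 1)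
        (mul_inv_cancel X)
      simp only [Matrix.GeneralLinearGroup.coe_mul, hX, Matrix.mul_apply, Fin.sum_univ_two] at e
      simpa using e
    obtain ⟨c, hc, h2⟩ := hq2 _ _ h'.symm
    have h3 := ((hpW i).2 (by rw [h2, Matrix.smul_apply, hXi, smul_zero])).2
    rw [(hq1 _).mpr h3] at h'
    exact hXc (by simpa using inv_mem ((hq1 _).mp h'.symm))

end RFArt

end

section

namespace RFArt

section Wreath
variable {X Q D : Type} [Group Q] [Group D] (q : X → Q) (ν : X → Q → D)

/-- The hom to the wreath product given by voltages. -/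
def wr : FreeGroup X →* D ≀ᵣ Q := FreeGroup.lift fun x => ⟨fun g => ν x g⁻¹, q x⟩

/-- The voltage of the path labelled by `a`, starting at `g`. -/
def val (a : FreeGroup X) (g : Q) : D := (wr q ν a).left g⁻¹

theorem wr_right (a : FreeGroup X) : (wr q ν a).right = FreeGroup.lift q a := by
  have : (RegularWreathProduct.rightHom).comp (wr q ν) = FreeGroup.lift q := by
    ext x
    simp [wr]
  exact DFunLike.congr_fun this a

@[simp] theorem val_one (g : Q) : val q ν 1 g = 1 := by simp [val]

@[simp] theorem val_of (x : X) (g : Q) : val q ν (FreeGroup.of x) g = ν x g := by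
  simp [val, wr]

theorem val_mul (a b : FreeGroup X) (g : Q) :
    val q ν (a * b) g = val q ν a g * val q ν b (g * FreeGroup.lift q a) := by
  simp [val, wr_right]

theorem val_inv (a : FreeGroup X) (g : Q) :
    val q ν a⁻¹ g = (val q ν a (g * (FreeGroup.lift q a)⁻¹))⁻¹ := by
  simp [val, wr_right]

/-- The holonomy homomorphism on the kernel. -/
def kerHom : (FreeGroup.lift q).ker →* D where
  toFun a := val q ν a 1
  map_one' := by simp
  map_mul' a b := by
    have : FreeGroup.lift q (a : FreeGroup X) = 1 := a.2
    simp [val_mul, this]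

theorem kerHom_apply (a : (FreeGroup.lift q).ker) : kerHom q ν a = val q ν a 1 := rfl

theorem val_pow_eq_one (x : X) (g : Q) (n : ℕ) (h : ∀ i < n, ν x (g * q x ^ i) = 1) :
    val q ν (FreeGroup.of x ^ n) g = 1 := by
  induction n with
  | zero => simp
  | succ n ih =>
    rw [pow_succ, val_mul, ih (fun i hi => h i (by omega))]
    simpa using h n (by omega)

theorem val_pow_last (x : X) (g : Q) (n : ℕ) (d : D) (hn : 1 ≤ n)
    (h : ∀ i, i + 1 < n → ν x (g * q x ^ i) = 1)
    (hd : ν x (g * q x ^ (n - 1)) = d) :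
    val q ν (FreeGroup.of x ^ n) g = d := by
  obtain ⟨n, rfl⟩ : ∃ m, n = m + 1 := ⟨n - 1, by omega⟩
  rw [pow_succ, val_mul, val_pow_eq_one q ν x g n (fun i hi => h i (by omega))]
  simpa using hd

theorem val_pow_first (x : X) (g : Q) (n : ℕ) (d : D) (hn : 1 ≤ n)
    (h : ∀ i, 1 ≤ i → i < n → ν x (g * q x ^ i) = 1)
    (hd : ν x g = d) :
    val q ν (FreeGroup.of x ^ n) g = d := by
  obtain ⟨n, rfl⟩ : ∃ m, n = m + 1 := ⟨n - 1, by omega⟩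
  rw [pow_succ', val_mul, val_pow_eq_one q ν x]
  · simpa using hd
  · intro i hi
    have := h (i + 1) (by omega) (by omega)
    rw [pow_succ'] at this
    simpa [mul_assoc] using this

end Wreath

/-- Sign on `B`. -/
def sgnGen : Fin 4 → ℤˣ := ![-1, 1, 1, 1]

/-- The index two subgroup `C` of the free group `B`. -/
def CC : Subgroup (FreeGroup (Fin 4)) := (FreeGroup.lift sgnGen).ker

instance : CC.Normal := by unfold CC; infer_instance
instance : CC.FiniteIndex := by unfold CC; exact Subgroup.finiteIndex_ker _

theorem mem_CC (b : FreeGroup (Fin 4)) : b ∈ CC ↔ FreeGroup.lift sgnGen b = 1 := MonoidHom.mem_ker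

/-- The generator `t * t` of `C`. -/
def ctt : CC := ⟨FreeGroup.of 0 * FreeGroup.of 0, by simp [mem_CC, sgnGen]⟩
/-- The generators `p, q, r` of `C`. -/
def cpp (i : Fin 3) : CC := ⟨FreeGroup.of i.succ, by fin_cases i <;> simp [mem_CC, sgnGen]⟩
/-- The conjugates of `p, q, r` by `t`. -/
def cpt (i : Fin 3) : CC := ⟨FreeGroup.of 0 * FreeGroup.of i.succ * (FreeGroup.of 0)⁻¹, by
  fin_cases i <;> simp [mem_CC, sgnGen]⟩

theorem CC_hom_ext {E : Type} [Group E] (f g : CC →* E) (h0 : f ctt = g ctt)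
    (h1 : ∀ i, f (cpp i) = g (cpp i)) (h2 : ∀ i, f (cpt i) = g (cpt i)) : f = g := by
  let D : Subgroup (FreeGroup (Fin 4)) := (f.eqLocus g).map CC.subtype
  have hD : ∀ c : CC, f c = g c → (c : FreeGroup (Fin 4)) ∈ D := fun c hc => ⟨c, hc, rfl⟩
  have d0 : FreeGroup.of 0 * FreeGroup.of 0 ∈ D := hD ctt h0
  have d1 : ∀ i : Fin 3, FreeGroup.of i.succ ∈ D := fun i => hD (cpp i) (h1 i)
  have d2 : ∀ i : Fin 3, FreeGroup.of 0 * FreeGroup.of i.succ * (FreeGroup.of 0)⁻¹ ∈ D :=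
    fun i => hD (cpt i) (h2 i)
  let P : FreeGroup (Fin 4) → Prop := fun d => d ∈ D ∨ FreeGroup.of 0 * d ∈ D
  have key : ∀ b d, P d → P (b * d) := by
    intro b
    induction b using FreeGroup.induction_on with
    | C1 => intro d hd; simpa using hd
    | of i =>
      intro d hd
      refine Fin.cases ?_ (fun i => ?_) i
      · rcases hd with hd | hd
        · right; rw [← mul_assoc]; exact mul_mem d0 hd
        · left; exact hd
      · rcases hd with hd | hd
        · left; exact mul_mem (d1 i) hd
        · right
          have := mul_mem (d2 i) hd
          simpa [mul_assoc] using this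
    | inv_of i ih =>
      intro d hd
      clear ih
      refine Fin.cases ?_ (fun i => ?_) i
      · rcases hd with hd | hd
        · right; simpa using hd
        · left
          have := mul_mem (inv_mem d0) hd
          simpa [mul_assoc] using this
      · rcases hd with hd | hd
        · left; exact mul_mem (inv_mem (d1 i)) hd
        · right
          have := mul_mem (inv_mem (d2 i)) hd
          simpa [mul_assoc] using this
    | mul x y hx hy => intro d hd; rw [mul_assoc]; exact hx _ (hy _ hd)
  ext c
  have h3 := key c 1 (Or.inl (one_mem D))
  rw [mul_one] at h3
  rcases h3 with h3 | h3
  · obtain ⟨c', hc', h4⟩ := h3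
    have : c' = c := Subtype.ext h4
    subst this
    exact hc'
  · exfalso
    obtain ⟨c', hc', h4⟩ := h3
    have h5 := (mem_CC _).mp c'.2
    have h6 := (mem_CC _).mp c.2
    have h7 : FreeGroup.lift sgnGen (c' : FreeGroup (Fin 4)) = -1 := by
      have h4 : (c' : FreeGroup (Fin 4)) = FreeGroup.of 0 * (c : FreeGroup (Fin 4)) := h4
      rw [h4, map_mul, h6]; simp [sgnGen]
    rw [h5] at h7
    exact absurd h7 (by decide)

section phiA
variable (k l m : ℕ)

local notation "xx" => (FreeGroup.of (0 : Fin 3))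
local notation "yy" => (FreeGroup.of (1 : Fin 3))
local notation "zz" => (FreeGroup.of (2 : Fin 3))

/-- The voltages defining `C → A`. -/
def nuA (i : Fin 4) (g : ℤˣ) : FreeGroup (Fin 3) :=
  if g = 1 then (![1, xx ^ k, yy ^ l, zz ^ m] : Fin 4 → FreeGroup (Fin 3)) i
  else (![xx * zz * yy, (xx * zz) * xx ^ k * (xx * zz)⁻¹, xx * yy ^ l * xx⁻¹,
    xx * zz ^ m * xx⁻¹] : Fin 4 → FreeGroup (Fin 3)) i

/-- The map `C → A`. -/
def phiA : CC →* FreeGroup (Fin 3) := kerHom sgnGen (nuA k l m)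

theorem phiA_apply (c : CC) : phiA k l m c = val sgnGen (nuA k l m) c 1 := rfl

theorem phiA_tt : phiA k l m ctt = xx * zz * yy := by
  simp [phiA_apply, ctt, val_mul, nuA, sgnGen]

theorem phiA_p : phiA k l m (cpp 0) = xx ^ k := by
  simp [phiA_apply, cpp, nuA]
theorem phiA_q : phiA k l m (cpp 1) = yy ^ l := by
  simp [phiA_apply, cpp, nuA]
theorem phiA_r : phiA k l m (cpp 2) = zz ^ m := by
  simp [phiA_apply, cpp, nuA]
theorem phiA_tp : phiA k l m (cpt 0) = (xx * zz) * xx ^ k * (xx * zz)⁻¹ := by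
  simp [phiA_apply, cpt, val_mul, val_inv, nuA, sgnGen]
theorem phiA_tq : phiA k l m (cpt 1) = xx * yy ^ l * xx⁻¹ := by
  simp [phiA_apply, cpt, val_mul, val_inv, nuA, sgnGen]
theorem phiA_tr : phiA k l m (cpt 2) = xx * zz ^ m * xx⁻¹ := by
  simp [phiA_apply, cpt, val_mul, val_inv, nuA, sgnGen]

end phiA

end RFArt

end

section

namespace RFArt

open Classical in
/-- The voltages defining the retraction `A₁ → C`. -/
noncomputable def nuC {T : Type} [Group T] (x y z : T) (i : Fin 3) (g : T) : CC :=
  (![if g = x⁻¹ then cpp 0 else if g = y⁻¹ then cpt 0 else 1,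
    if g = 1 then cpp 1 * ctt⁻¹ else if g = y⁻¹ then ctt else if g = x then cpt 1 else 1,
    if g = 1 then cpp 2 else if g = x * z⁻¹ then cpt 2 else 1] : Fin 3 → CC) i

theorem ne_zpow_of_ne_pow {T : Type} [Group T] [Finite T] (x y : T) (h : ∀ i : ℕ, x ^ i ≠ y)
    (i : ℤ) : x ^ i ≠ y := by
  intro hi
  have : y ∈ Subgroup.zpowers x := ⟨i, hi⟩
  rw [← mem_powers_iff_mem_zpowers] at this
  obtain ⟨n, hn⟩ := this
  exact h n hn

theorem retraction_exists (k l m : ℕ) (hk : 2 ≤ k) (hl : 2 ≤ l) (hm : 2 ≤ m) :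
    ∃ (K : Subgroup (FreeGroup (Fin 3))) (_ : K.Normal) (_ : K.FiniteIndex)
      (hK : ∀ c, phiA k l m c ∈ K) (r : K →* CC), ∀ c, r ⟨phiA k l m c, hK c⟩ = c := by
  obtain ⟨T, _, _, x, y, z, hxzy, ox, oy, oz, hxy, hyx, hzx⟩ := exists_triangle k l m hk hl hm
  have zxy := ne_zpow_of_ne_pow _ _ hxy
  have zyx := ne_zpow_of_ne_pow _ _ hyx
  have zzx := ne_zpow_of_ne_pow _ _ hzx
  let qT : Fin 3 → T := ![x, y, z]
  let f : FreeGroup (Fin 3) →* T := FreeGroup.lift qT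
  have f0 : FreeGroup.lift qT (FreeGroup.of 0) = x := by simp [qT]
  have f1 : FreeGroup.lift qT (FreeGroup.of 1) = y := by simp [qT]
  have f2 : FreeGroup.lift qT (FreeGroup.of 2) = z := by simp [qT]
  have q0 : qT 0 = x := rfl
  have q1 : qT 1 = y := rfl
  have q2 : qT 2 = z := rfl
  have xk : x ^ k = 1 := by rw [← ox]; exact pow_orderOf_eq_one x
  have yl : y ^ l = 1 := by rw [← oy]; exact pow_orderOf_eq_one y
  have zm : z ^ m = 1 := by rw [← oz]; exact pow_orderOf_eq_one z
  have xi : ∀ i, 0 < i → i < k → x ^ i ≠ 1 := fun i h1 h2 h3 => by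
    rw [← orderOf_dvd_iff_pow_eq_one, ox] at h3
    exact absurd (Nat.le_of_dvd h1 h3) (by omega)
  have yi : ∀ i, 0 < i → i < l → y ^ i ≠ 1 := fun i h1 h2 h3 => by
    rw [← orderOf_dvd_iff_pow_eq_one, oy] at h3
    exact absurd (Nat.le_of_dvd h1 h3) (by omega)
  have zi : ∀ i, 0 < i → i < m → z ^ i ≠ 1 := fun i h1 h2 h3 => by
    rw [← orderOf_dvd_iff_pow_eq_one, oz] at h3
    exact absurd (Nat.le_of_dvd h1 h3) (by omega)
  have xinv : x ^ (k - 1) = x⁻¹ := by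
    rw [eq_inv_iff_mul_eq_one, ← pow_succ, Nat.sub_add_cancel (by omega), xk]
  have yinv : y ^ (l - 1) = y⁻¹ := by
    rw [eq_inv_iff_mul_eq_one, ← pow_succ, Nat.sub_add_cancel (by omega), yl]
  have zinv : z ^ (m - 1) = z⁻¹ := by
    rw [eq_inv_iff_mul_eq_one, ← pow_succ, Nat.sub_add_cancel (by omega), zm]
  have x1 : x ≠ 1 := by simpa using xi 1 (by omega) (by omega)
  have y1 : y ≠ 1 := by simpa using yi 1 (by omega) (by omega)
  have z1 : z ≠ 1 := by simpa using zi 1 (by omega) (by omega)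
  have hxz : x * z = y⁻¹ := eq_inv_of_mul_eq_one_left hxzy
  -- the voltages
  let ν := nuC x y z
  have n0a : ν 0 x⁻¹ = cpp 0 := by simp [ν, nuC]
  have hyx' : y⁻¹ ≠ x⁻¹ := fun h => hxy 1 (by rw [pow_one]; exact (inv_injective h).symm)
  have n0b : ν 0 y⁻¹ = cpt 0 := by simp [ν, nuC, show y ≠ x from fun h => hyx' (by rw [h])]
  have n0c : ∀ g, g ≠ x⁻¹ → g ≠ y⁻¹ → ν 0 g = 1 := fun g h1 h2 => by simp [ν, nuC, h1, h2]
  have n1a : ν 1 1 = cpp 1 * ctt⁻¹ := by simp [ν, nuC]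
  have n1b : ν 1 y⁻¹ = ctt := by simp [ν, nuC, y1]
  have hxy' : x ≠ y⁻¹ := fun h => zyx (-1) (by simpa using h.symm)
  have n1c : ν 1 x = cpt 1 := by simp [ν, nuC, x1, hxy']
  have n1d : ∀ g, g ≠ 1 → g ≠ y⁻¹ → g ≠ x → ν 1 g = 1 := fun g h1 h2 h3 => by
    simp [ν, nuC, h1, h2, h3]
  have n2a : ν 2 1 = cpp 2 := by simp [ν, nuC]
  have hxz1 : x * z⁻¹ ≠ 1 := fun h => hzx 1 (by rw [pow_one]; exact (mul_inv_eq_one.mp h).symm)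
  have n2b : ν 2 (x * z⁻¹) = cpt 2 := by simp only [ν, nuC]; simp [hxz1]
  have n2c : ∀ g, g ≠ 1 → g ≠ x * z⁻¹ → ν 2 g = 1 := fun g h1 h2 => by simp [ν, nuC, h1, h2]
  have hx0 : ν 0 1 = 1 := n0c 1 (fun h => x1 (by simpa using h.symm))
    (fun h => y1 (by simpa using h.symm))
  have hz0 : ν 2 x = 1 := n2c x x1 (fun h => z1 (by simpa using h))
  let K := f.ker
  have hK : ∀ c, phiA k l m c ∈ K := by
    have : f.comp (phiA k l m) = 1 := by
      apply CC_hom_ext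
      · simp [phiA_tt, f, f0, f1, f2, hxzy]
      · intro i
        fin_cases i
        · simp [phiA_p, f, f0, xk]
        · simp [phiA_q, f, f1, yl]
        · simp [phiA_r, f, f2, zm]
      · intro i
        fin_cases i
        · simp [phiA_tp, f, f0, f2, xk]
        · simp [phiA_tq, f, f0, f1, yl]
        · simp [phiA_tr, f, f0, f2, zm]
    intro c
    exact DFunLike.congr_fun this c
  let r : K →* CC := kerHom qT ν
  have hr : ∀ c, r ⟨phiA k l m c, hK c⟩ = val qT ν (phiA k l m c) 1 := fun c => rfl
  refine ⟨K, inferInstance, Subgroup.finiteIndex_ker f, hK, r, ?_⟩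
  have : r.comp ((phiA k l m).codRestrict K hK) = MonoidHom.id CC := by
    have hr' : ∀ c, (r.comp ((phiA k l m).codRestrict K hK)) c = val qT ν (phiA k l m c) 1 := hr
    apply CC_hom_ext
    · rw [hr', phiA_tt, val_mul, val_mul]
      simp only [map_mul, f0, f2, one_mul, val_of, hxz, hx0, hz0, n1b]; rfl
    · intro i
      rw [hr']
      fin_cases i
      · change val qT ν (phiA k l m (cpp 0)) 1 = cpp 0
        rw [phiA_p]
        apply val_pow_last _ _ _ _ _ _ (by omega)
        · intro i hi
          rw [q0, one_mul]
          apply n0c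
          · intro h
            rw [eq_inv_iff_mul_eq_one, ← pow_succ] at h
            exact xi _ (by omega) hi h
          · intro h
            exact zxy (-i) (by rw [zpow_neg, zpow_natCast, h, inv_inv])
        · rw [q0, one_mul, xinv, n0a]
      · change val qT ν (phiA k l m (cpp 1)) 1 = cpp 1
        rw [phiA_q]
        obtain ⟨l', rfl⟩ : ∃ l', l = l' + 2 := ⟨l - 2, by omega⟩
        rw [show FreeGroup.of (1 : Fin 3) ^ (l' + 2) =
          FreeGroup.of 1 ^ (l' + 1) * FreeGroup.of 1 by rw [← pow_succ], val_mul]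
        rw [val_pow_first qT ν 1 1 (l' + 1) (cpp 1 * ctt⁻¹) (by omega) _ n1a]
        · rw [val_of, map_pow, f1, one_mul, show l' + 1 = l' + 2 - 1 by omega, yinv, n1b]
          simp
        · intro i h1 h2
          rw [q1, one_mul]
          apply n1d
          · exact yi i (by omega) (by omega)
          · intro h
            rw [eq_inv_iff_mul_eq_one, ← pow_succ] at h
            exact yi _ (by omega) (by omega) h
          · exact hyx i
      · change val qT ν (phiA k l m (cpp 2)) 1 = cpp 2
        rw [phiA_r]
        apply val_pow_first _ _ _ _ _ _ (by omega) _ n2a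
        intro i h1 h2
        rw [q2, one_mul]
        apply n2c
        · exact zi i (by omega) h2
        · intro h
          exact hzx (i + 1) (by rw [pow_succ, h]; simp)
    · intro i
      rw [hr']
      fin_cases i
      · change val qT ν (phiA k l m (cpt 0)) 1 = cpt 0
        rw [phiA_tp, val_mul, val_mul, val_mul, val_inv, val_mul]
        simp only [map_mul, map_pow, f0, f2, one_mul, val_of, hx0, hz0, xk, mul_one,
          mul_inv_cancel, inv_one]
        rw [hxz]
        apply val_pow_first _ _ _ _ _ _ (by omega) _ n0b
        intro i h1 h2
        rw [q0]
        apply n0c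
        · intro h
          have : y = x ^ (i + 1) := by
            have : x ^ i = y * x⁻¹ := by rw [← h]; simp
            rw [pow_succ, this]; simp
          exact hxy _ this.symm
        · intro h
          exact xi i (by omega) h2 (by simpa using h)
      · change val qT ν (phiA k l m (cpt 1)) 1 = cpt 1
        rw [phiA_tq, val_mul, val_mul, val_inv]
        simp only [map_mul, map_pow, f0, f1, one_mul, val_of, hx0, yl, mul_one,
          mul_inv_cancel, inv_one]
        apply val_pow_first _ _ _ _ _ _ (by omega) _ n1c
        intro i h1 h2
        rw [q1]
        apply n1d
        · intro h
          exact zyx (-i) (by rw [zpow_neg, zpow_natCast]; exact (eq_inv_of_mul_eq_one_left h).symm)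
        · intro h
          refine zyx (-(i + 1 : ℕ)) ?_
          rw [zpow_neg, zpow_natCast, inv_eq_iff_mul_eq_one, pow_succ']
          rw [eq_inv_iff_mul_eq_one] at h
          have : y * (x * y ^ i) = 1 := mul_eq_one_iff_eq_inv.mpr
            (by rw [eq_inv_of_mul_eq_one_left h, inv_inv])
          rw [← inv_eq_iff_mul_eq_one]
          have h4 : x * y ^ i = y⁻¹ := (eq_inv_of_mul_eq_one_left h)
          have h5 : x = y⁻¹ * (y ^ i)⁻¹ := by rw [← h4]; simp
          rw [h5, ← mul_inv_rev, ← pow_succ, ← pow_succ']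
        · intro h
          exact yi i (by omega) h2 (by simpa using h)
      · change val qT ν (phiA k l m (cpt 2)) 1 = cpt 2
        rw [phiA_tr, val_mul, val_mul, val_inv]
        simp only [map_mul, map_pow, f0, f2, one_mul, val_of, hx0, zm, mul_one,
          mul_inv_cancel, inv_one]
        apply val_pow_last _ _ _ _ _ _ (by omega)
        · intro i hi
          rw [q2]
          apply n2c
          · intro h
            exact zzx (-i) (by
              rw [zpow_neg, zpow_natCast]; exact (eq_inv_of_mul_eq_one_left h).symm)
          · intro h
            have h := mul_left_cancel h
            rw [eq_inv_iff_mul_eq_one, ← pow_succ] at h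
            exact zi _ (by omega) hi h
        · rw [q2, zinv, n2b]
  intro c
  exact DFunLike.congr_fun this c

end RFArt

end

section

namespace RFArt

theorem comm_of_rel {G : Type} [Group G] (a b : G) (k : ℕ) (h : (a * b) ^ k = (b * a) ^ k) :
    a * (a * b) ^ k = (a * b) ^ k * a ∧ b * (a * b) ^ k = (a * b) ^ k * b := by
  have e1 : ∀ k : ℕ, a * (b * a) ^ k = (a * b) ^ k * a := by
    intro k
    induction k with
    | zero => simp
    | succ k ih => rw [pow_succ, ← mul_assoc, ih, pow_succ]; simp [mul_assoc]
  have e2 : ∀ k : ℕ, b * (a * b) ^ k = (b * a) ^ k * b := by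
    intro k
    induction k with
    | zero => simp
    | succ k ih => rw [pow_succ, ← mul_assoc, ih, pow_succ]; simp [mul_assoc]
  exact ⟨by rw [h, e1, h], by rw [e2, h]⟩

theorem rel_of_comm {G : Type} [Group G] (a b : G) (k : ℕ)
    (h : a * (a * b) ^ k = (a * b) ^ k * a) : (a * b) ^ k = (b * a) ^ k := by
  have e1 : ∀ k : ℕ, a * (b * a) ^ k = (a * b) ^ k * a := by
    intro k
    induction k with
    | zero => simp
    | succ k ih => rw [pow_succ, ← mul_assoc, ih, pow_succ]; simp [mul_assoc]
  rw [← e1] at h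
  exact mul_left_cancel h

/-- Ranks of the two free factors. -/
def nn : Bool → ℕ
  | false => 3
  | true => 4

/-- The two inclusions of the edge group. -/
def phi2 (k l m : ℕ) : ∀ i : Bool, CC →* FreeGroup (Fin (nn i))
  | false => phiA k l m
  | true => CC.subtype

theorem pushout_RF (k l m : ℕ) (hk : 2 ≤ k) (hl : 2 ≤ l) (hm : 2 ≤ m) :
    ResiduallyFinite (Monoid.PushoutI (phi2 k l m)) := by
  obtain ⟨K, hKn, hKf, hK, r, hr⟩ := retraction_exists k l m hk hl hm
  let KK : ∀ i : Bool, Subgroup (FreeGroup (Fin (nn i))) := fun i =>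
    match i with
    | false => K
    | true => CC
  have hKK : ∀ i h, phi2 k l m i h ∈ KK i := fun i =>
    match i with
    | false => hK
    | true => fun c => c.2
  let ρ : ∀ i : Bool, KK i →* CC := fun i =>
    match i with
    | false => r
    | true => MonoidHom.id CC
  refine amalgam_RF (phi2 k l m) (fun i => inferInstance) (fun i => freeGroup_RF _) KK ?_ ?_ hKK ρ ?_
  · intro i; cases i
    · exact hKn
    · exact (inferInstance : CC.Normal)
  · intro i; cases i
    · exact hKf
    · exact (inferInstance : CC.FiniteIndex)
  · intro i; cases i
    · exact hr
    · intro c; rfl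

theorem tri_RF {G : Type} [Group G] (a b c : G) (k l m : ℕ) (hk : 2 ≤ k) (hl : 2 ≤ l) (hm : 2 ≤ m)
    (hab : (a * b) ^ k = (b * a) ^ k) (hbc : (b * c) ^ l = (c * b) ^ l)
    (hca : (c * a) ^ m = (a * c) ^ m)
    (huniv : ∀ (P : Type) [Group P] (a' b' c' : P), (a' * b') ^ k = (b' * a') ^ k →
      (b' * c') ^ l = (c' * b') ^ l → (c' * a') ^ m = (a' * c') ^ m →
      ∃ Φ : G →* P, Φ a = a' ∧ Φ b = b' ∧ Φ c = c')
    (hgen : ∀ f : G →* G, f a = a → f b = b → f c = c → ∀ g, f g = g) :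
    ResiduallyFinite G := by
  let P := Monoid.PushoutI (phi2 k l m)
  let oA : FreeGroup (Fin 3) →* P := Monoid.PushoutI.of (φ := phi2 k l m) false
  let oB : FreeGroup (Fin 4) →* P := Monoid.PushoutI.of (φ := phi2 k l m) true
  have hoAB : ∀ d : CC, oA (phiA k l m d) = oB d := by
    intro d
    have h1 := Monoid.PushoutI.of_apply_eq_base (phi2 k l m) false d
    have h2 := Monoid.PushoutI.of_apply_eq_base (phi2 k l m) true d
    exact h1.trans h2.symm
  obtain ⟨x, hx⟩ : ∃ x, x = oA (FreeGroup.of 0) := ⟨_, rfl⟩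
  obtain ⟨y, hy⟩ : ∃ y, y = oA (FreeGroup.of 1) := ⟨_, rfl⟩
  obtain ⟨z, hz⟩ : ∃ z, z = oA (FreeGroup.of 2) := ⟨_, rfl⟩
  obtain ⟨t, ht⟩ : ∃ t, t = oB (FreeGroup.of 0) := ⟨_, rfl⟩
  have r0 : x * z * y = t * t := by
    have := hoAB ctt
    rw [phiA_tt] at this
    simpa [ctt, hx, hy, hz, ht] using this
  have rp : x ^ k = oB (FreeGroup.of 1) := by
    have := hoAB (cpp 0)
    rw [phiA_p] at this
    simpa [cpp, hx] using this
  have rq : y ^ l = oB (FreeGroup.of 2) := by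
    have := hoAB (cpp 1)
    rw [phiA_q] at this
    simpa [cpp, hy] using this
  have rr : z ^ m = oB (FreeGroup.of 3) := by
    have := hoAB (cpp 2)
    rw [phiA_r] at this
    simpa [cpp, hz] using this
  have tp : (x * z) * x ^ k * (x * z)⁻¹ = t * x ^ k * t⁻¹ := by
    have := hoAB (cpt 0)
    rw [phiA_tp] at this
    rw [rp]
    simpa [cpt, hx, hz, ht, ← rp] using this
  have tq : x * y ^ l * x⁻¹ = t * y ^ l * t⁻¹ := by
    have := hoAB (cpt 1)
    rw [phiA_tq] at this
    rw [rq]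
    simpa [cpt, hx, hy, ht, ← rq] using this
  have tr : x * z ^ m * x⁻¹ = t * z ^ m * t⁻¹ := by
    have := hoAB (cpt 2)
    rw [phiA_tr] at this
    rw [rr]
    simpa [cpt, hx, hz, ht, ← rr] using this
  have eab : (t * y⁻¹) * (y * t⁻¹ * x) = x := by group
  have ebc : (y * t⁻¹ * x) * (x⁻¹ * t) = y := by group
  have eca : (x⁻¹ * t) * (t * y⁻¹) = z := by
    have : x⁻¹ * t * (t * y⁻¹) = x⁻¹ * (t * t) * y⁻¹ := by group
    rw [this, ← r0]; group
  obtain ⟨Φ, Φa, Φb, Φc⟩ := huniv P (t * y⁻¹) (y * t⁻¹ * x) (x⁻¹ * t)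
    (by
      apply rel_of_comm
      rw [eab]
      have h1 : x * z = t * t * y⁻¹ := by rw [← r0]; group
      rw [h1] at tp
      have h2 : t * (t * y⁻¹ * x ^ k) * (t * y⁻¹)⁻¹ * t⁻¹  = t * x ^ k * t⁻¹ := by
        rw [← tp]; group
      have h3 := mul_left_cancel (mul_right_cancel (by
        rw [← h2]; simp only [mul_assoc] :
          t * (t * y⁻¹ * x ^ k * (t * y⁻¹)⁻¹) * t⁻¹ = t * (x ^ k) * t⁻¹))
      rw [mul_inv_eq_iff_eq_mul] at h3
      exact h3)
    (by
      apply rel_of_comm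
      rw [ebc]
      have h1 : x * y ^ l = t * y ^ l * t⁻¹ * x := by rw [← tq]; group
      rw [mul_assoc, h1]; group)
    (by
      apply rel_of_comm
      rw [eca]
      have h1 : t * z ^ m = x * z ^ m * x⁻¹ * t := by rw [tr]; group
      rw [mul_assoc, h1]; simp only [mul_assoc, inv_mul_cancel_left])
  have cab := comm_of_rel a b k hab
  have cbc := comm_of_rel b c l hbc
  have cca := comm_of_rel c a m hca
  let ΨA : FreeGroup (Fin 3) →* G := FreeGroup.lift ![a * b, b * c, c * a]
  let ΨB : FreeGroup (Fin 4) →* G :=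
    FreeGroup.lift ![a * b * c, (a * b) ^ k, (b * c) ^ l, (c * a) ^ m]
  have hΨ : ΨA.comp (phiA k l m) = ΨB.comp CC.subtype := by
    apply CC_hom_ext
    · change ΨA (phiA k l m ctt) = ΨB (ctt : FreeGroup (Fin 4))
      rw [phiA_tt]
      simp [ctt, ΨA, ΨB, mul_assoc]
    · intro i
      fin_cases i
      · change ΨA (phiA k l m (cpp 0)) = ΨB (cpp 0 : FreeGroup (Fin 4))
        rw [phiA_p]
        simp [cpp, ΨA, ΨB]
      · change ΨA (phiA k l m (cpp 1)) = ΨB (cpp 1 : FreeGroup (Fin 4))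
        rw [phiA_q]
        simp [cpp, ΨA, ΨB]
      · change ΨA (phiA k l m (cpp 2)) = ΨB (cpp 2 : FreeGroup (Fin 4))
        rw [phiA_r]
        simp [cpp, ΨA, ΨB]
    · intro i
      fin_cases i
      · have e : (a * b * (c * a)) * (a * b) ^ k * (a * b * (c * a))⁻¹ =
            (a * b * c) * (a * b) ^ k * (a * b * c)⁻¹ := by
          have : (a * b * (c * a)) * (a * b) ^ k = (a * b * c) * (a * b) ^ k * a := by
            rw [mul_assoc _ ((a * b) ^ k) a, ← cab.1]; simp only [mul_assoc]
          rw [this]; simp only [mul_inv_rev]; simp only [mul_assoc, mul_inv_cancel_left]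
        change ΨA (phiA k l m (cpt 0)) = ΨB (cpt 0 : FreeGroup (Fin 4))
        rw [phiA_tp]
        simpa [cpt, ΨA, ΨB] using e
      · have e : (a * b) * (b * c) ^ l * (a * b)⁻¹ =
            (a * b * c) * (b * c) ^ l * (a * b * c)⁻¹ := by
          rw [mul_assoc (a * b) c, cbc.2, mul_inv_rev _ c]
          simp only [mul_assoc, mul_inv_cancel_left]
        change ΨA (phiA k l m (cpt 1)) = ΨB (cpt 1 : FreeGroup (Fin 4))
        rw [phiA_tq]
        simpa [cpt, ΨA, ΨB] using e
      · have e : (a * b) * (c * a) ^ m * (a * b)⁻¹ =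
            (a * b * c) * (c * a) ^ m * (a * b * c)⁻¹ := by
          rw [mul_assoc (a * b) c, cca.1, mul_inv_rev _ c]
          simp only [mul_assoc, mul_inv_cancel_left]
        change ΨA (phiA k l m (cpt 2)) = ΨB (cpt 2 : FreeGroup (Fin 4))
        rw [phiA_tr]
        simpa [cpt, ΨA, ΨB] using e
  let Ψi : ∀ i : Bool, FreeGroup (Fin (nn i)) →* G := fun i =>
    match i with
    | false => ΨA
    | true => ΨB
  let Ψ : P →* G := Monoid.PushoutI.lift Ψi (ΨB.comp CC.subtype) (by
    intro i; cases i
    · exact hΨ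
    · rfl)
  have ΨA' : ∀ w, Ψ (oA w) = ΨA w := fun w =>
    Monoid.PushoutI.lift_of (i := false) Ψi _ _ w
  have ΨB' : ∀ w, Ψ (oB w) = ΨB w := fun w =>
    Monoid.PushoutI.lift_of (i := true) Ψi _ _ w
  have Ψx : Ψ x = a * b := by rw [hx, ΨA']; simp [ΨA]
  have Ψy : Ψ y = b * c := by rw [hy, ΨA']; simp [ΨA]
  have Ψt : Ψ t = a * b * c := by rw [ht, ΨB']; simp [ΨB]
  refine RF_of_leftInverse Φ Ψ ?_ (pushout_RF k l m hk hl hm)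
  apply hgen (Ψ.comp Φ)
  · simp only [MonoidHom.comp_apply, Φa, map_mul, map_inv, Ψt, Ψy]; group
  · simp only [MonoidHom.comp_apply, Φb, map_mul, map_inv, Ψt, Ψy, Ψx]; group
  · simp only [MonoidHom.comp_apply, Φc, map_mul, map_inv, Ψt, Ψx]; group

end RFArt

end

section

namespace RFArt

open scoped Classical

theorem lift_alt {V G : Type} [Group G] (f : V → G) (a b : V) (k : ℕ) :
    FreeGroup.lift f (altWord a b (2 * k)) = (f a * f b) ^ k := by
  induction k with
  | zero => simp [altWord]
  | succ k ih =>
    have h : altWord a b (2 * (k + 1)) =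
        altWord a b (2 * k) * (FreeGroup.of a * FreeGroup.of b) := by
      have e : 2 * (k + 1) = 2 * k + 1 + 1 := by ring
      have e2 : (2 * k + 1) % 2 = 1 := by omega
      simp [altWord, e, List.range_succ, e2, mul_assoc]
    rw [h, map_mul, ih, pow_succ]
    simp

/-- Artin relators together with the generators outside `U`. -/
def KRels {V : Type} (Γ : SimpleGraph V) (M : V → V → ℕ) (U : Finset V) : Set (FreeGroup V) :=
  artinRels Γ M ∪ {r | ∃ v, v ∉ U ∧ r = FreeGroup.of v}

/-- The Artin group of the full subgraph on `U`, presented as a quotient. -/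
abbrev KG {V : Type} (Γ : SimpleGraph V) (M : V → V → ℕ) (U : Finset V) : Type :=
  PresentedGroup (KRels Γ M U)

/-- The generators. -/
def gen {V : Type} (Γ : SimpleGraph V) (M : V → V → ℕ) (U : Finset V) (v : V) : KG Γ M U :=
  PresentedGroup.of v

section
variable {V : Type} (Γ : SimpleGraph V) (M : V → V → ℕ)

theorem lift_artin_iff {G : Type} [Group G] (f : V → G)
    (a b : V) (he : Even (M a b)) :
    FreeGroup.lift f (altWord a b (M a b) * (altWord b a (M a b))⁻¹) = 1 ↔
      (f a * f b) ^ (M a b / 2) = (f b * f a) ^ (M a b / 2) := by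
  obtain ⟨k, hk⟩ := he
  have h2 : M a b = 2 * k := by omega
  have h3 : M a b / 2 = k := by omega
  rw [h3, map_mul, map_inv, h2, lift_alt, lift_alt, mul_inv_eq_one]

theorem gen_one (U : Finset V) (v : V) (hv : v ∉ U) : gen Γ M U v = 1 := by
  apply PresentedGroup.one_of_mem
  exact Or.inr ⟨v, hv, rfl⟩

theorem gen_rel (heven : ∀ a b, Γ.Adj a b → Even (M a b)) (U : Finset V) (a b : V)
    (h : Γ.Adj a b) : (gen Γ M U a * gen Γ M U b) ^ (M a b / 2) =
      (gen Γ M U b * gen Γ M U a) ^ (M a b / 2) := by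
  rw [← lift_artin_iff M (gen Γ M U) a b (heven a b h)]
  have e : FreeGroup.lift (gen Γ M U) = PresentedGroup.mk (KRels Γ M U) := by
    ext v; simp [gen, PresentedGroup.of]
  rw [e]
  apply PresentedGroup.one_of_mem
  exact Or.inl ⟨a, b, h, rfl⟩

theorem exists_hom (heven : ∀ a b, Γ.Adj a b → Even (M a b)) (U : Finset V)
    {G : Type} [Group G] (f : V → G)
    (h1 : ∀ a b, Γ.Adj a b → (f a * f b) ^ (M a b / 2) = (f b * f a) ^ (M a b / 2))
    (h2 : ∀ v, v ∉ U → f v = 1) : ∃ φ : KG Γ M U →* G, ∀ v, φ (gen Γ M U v) = f v := by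
  have h : ∀ r ∈ KRels Γ M U, FreeGroup.lift f r = 1 := by
    rintro r (⟨a, b, hab, rfl⟩ | ⟨v, hv, rfl⟩)
    · exact (lift_artin_iff M f a b (heven a b hab)).2 (h1 a b hab)
    · simpa using h2 v hv
  exact ⟨PresentedGroup.toGroup h, fun v => PresentedGroup.toGroup.of h⟩

theorem hom_id (U : Finset V) (f : KG Γ M U →* KG Γ M U)
    (h : ∀ v, f (gen Γ M U v) = gen Γ M U v) (x : KG Γ M U) : f x = x := by
  have : f = MonoidHom.id _ := PresentedGroup.ext h
  rw [this]; rfl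

theorem exists_incl (heven : ∀ a b, Γ.Adj a b → Even (M a b)) (U U' : Finset V) :
    ∃ φ : KG Γ M U →* KG Γ M U', ∀ v, (v ∈ U' → v ∈ U) → φ (gen Γ M U v) = gen Γ M U' v := by
  obtain ⟨φ, hφ⟩ := exists_hom Γ M heven U (fun v => if v ∈ U then gen Γ M U' v else 1)
    (by
      intro a b h
      by_cases ha : a ∈ U <;> by_cases hb : b ∈ U <;> simp [ha, hb]
      exact gen_rel Γ M heven U' a b h)
    (by intro v hv; simp [hv])
  refine ⟨φ, fun v hv => ?_⟩
  rw [hφ]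
  by_cases h : v ∈ U
  · simp [h]
  · simp [h, gen_one Γ M U' v (fun h' => h (hv h'))]

instance KG_FG [Finite V] (U : Finset V) : Group.FG (KG Γ M U) :=
  Group.fg_of_surjective (f := PresentedGroup.mk (KRels Γ M U))
    (PresentedGroup.mk_surjective _)

/-- The two pieces of the splitting. -/
noncomputable def Us (U : Finset V) (u w : V) : Bool → Finset V
  | false => U.erase u
  | true => U.erase w

theorem split_RF [Finite V] (heven : ∀ a b, Γ.Adj a b → Even (M a b))
    (hsymm : ∀ a b, M a b = M b a) (U : Finset V) (u w : V)
    (huw : u ≠ w) (hn : ¬ Γ.Adj u w)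
    (hRF : ∀ i, ResiduallyFinite (KG Γ M (Us U u w i))) : ResiduallyFinite (KG Γ M U) := by
  let U0 : Finset V := (U.erase u).erase w
  have hm0 : ∀ v, v ∈ U0 ↔ v ≠ w ∧ v ≠ u ∧ v ∈ U := by intro v; simp [U0]
  have hmf : ∀ v, v ∈ Us U u w false ↔ v ≠ u ∧ v ∈ U := by intro v; simp [Us]
  have hmt : ∀ v, v ∈ Us U u w true ↔ v ≠ w ∧ v ∈ U := by intro v; simp [Us]
  have h0 : ∀ i v, v ∈ U0 → v ∈ Us U u w i := by
    intro i v hv; rw [hm0] at hv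
    cases i
    · rw [hmf]; tauto
    · rw [hmt]; tauto
  -- sections send generators of U0 to generators
  have hσ : ∀ i, ∃ φ : KG Γ M U0 →* KG Γ M (Us U u w i), ∀ v, v ∈ U0 →
      φ (gen Γ M U0 v) = gen Γ M _ v := by
    intro i
    obtain ⟨φ, hφ⟩ := exists_incl Γ M heven U0 (Us U u w i)
    exact ⟨φ, fun v hv => hφ v fun _ => hv⟩
  choose σ hσ using hσ
  have hρ : ∀ i, ∃ φ : KG Γ M (Us U u w i) →* KG Γ M U0, ∀ v,
      φ (gen Γ M _ v) = gen Γ M U0 v := by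
    intro i
    obtain ⟨φ, hφ⟩ := exists_incl Γ M heven (Us U u w i) U0
    exact ⟨φ, fun v => hφ v (h0 i v)⟩
  choose ρ hρ using hρ
  have hρσ : ∀ i x, ρ i (σ i x) = x := by
    intro i
    refine hom_id Γ M U0 ((ρ i).comp (σ i)) fun v => ?_
    by_cases hv : v ∈ U0
    · rw [MonoidHom.comp_apply, hσ i v hv, hρ]
    · rw [gen_one Γ M U0 v hv, map_one]
  have hP : ResiduallyFinite (Monoid.PushoutI σ) := by
    refine amalgam_RF σ (fun i => inferInstance) hRF (fun _ => ⊤) (fun _ => inferInstance)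
      (fun _ => inferInstance) (fun _ _ => Subgroup.mem_top _)
      (fun i => (ρ i).comp (Subgroup.subtype _)) ?_
    intro i h
    exact hρσ i h
  let o : ∀ i, KG Γ M (Us U u w i) →* Monoid.PushoutI σ := fun i =>
    Monoid.PushoutI.of (φ := σ) i
  have ho : ∀ v, v ∈ U0 → o false (gen Γ M _ v) = o true (gen Γ M _ v) := by
    intro v hv
    rw [← hσ false v hv, ← hσ true v hv]
    exact (Monoid.PushoutI.of_apply_eq_base σ false _).trans
      (Monoid.PushoutI.of_apply_eq_base σ true _).symm
  let F : V → Monoid.PushoutI σ := fun v =>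
    if v = u then o true (gen Γ M _ v) else o false (gen Γ M _ v)
  have Ff : ∀ v, v ≠ u → F v = o false (gen Γ M _ v) := fun v hv => by simp [F, hv]
  have Ft : ∀ v, v ≠ w → F v = o true (gen Γ M _ v) := by
    intro v hv
    by_cases hu : v = u
    · simp [F, hu]
    · rw [Ff v hu]
      by_cases hU : v ∈ U
      · exact ho v ((hm0 v).2 ⟨hv, hu, hU⟩)
      · rw [gen_one Γ M _ v (by rw [hmf]; tauto), gen_one Γ M _ v (by rw [hmt]; tauto),
          map_one, map_one]
  have rel : ∀ i a b, Γ.Adj a b → F a = o i (gen Γ M _ a) → F b = o i (gen Γ M _ b) →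
      (F a * F b) ^ (M a b / 2) = (F b * F a) ^ (M a b / 2) := by
    intro i a b h ha hb
    rw [ha, hb, ← map_mul, ← map_mul, ← map_pow, ← map_pow, gen_rel Γ M heven _ a b h]
  obtain ⟨Φ, hΦ⟩ := exists_hom Γ M heven U F
    (by
      intro a b h
      by_cases ha : a = u
      · subst ha
        exact rel true a b h (Ft a huw) (Ft b (by rintro rfl; exact hn h))
      · by_cases hb : b = u
        · subst hb
          exact rel true a b h (Ft a (by rintro rfl; exact hn h.symm)) (Ft b huw)
        · exact rel false a b h (Ff a ha) (Ff b hb))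
    (by
      intro v hv
      by_cases hu : v = u
      · rw [Ft v (hu ▸ huw), gen_one Γ M _ v (by rw [hmt]; tauto), map_one]
      · rw [Ff v hu, gen_one Γ M _ v (by rw [hmf]; tauto), map_one])
  have hτ : ∀ i, ∃ φ : KG Γ M (Us U u w i) →* KG Γ M U, ∀ v,
      (v ∈ U → v ∈ Us U u w i) → φ (gen Γ M _ v) = gen Γ M U v :=
    fun i => exists_incl Γ M heven _ _
  choose τ hτ using hτ
  obtain ⟨τ0, hτ0⟩ := exists_incl Γ M heven U0 U
  have hcomp : ∀ i, (τ i).comp (σ i) = τ0 := by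
    intro i
    refine PresentedGroup.ext fun v => ?_
    change τ i (σ i (gen Γ M U0 v)) = τ0 (gen Γ M U0 v)
    by_cases hv : v ∈ U0
    · rw [hσ i v hv, hτ i v (fun _ => h0 i v hv), hτ0 v fun _ => hv]
    · rw [gen_one Γ M U0 v hv, map_one, map_one, map_one]
  let Ψ : Monoid.PushoutI σ →* KG Γ M U := Monoid.PushoutI.lift τ τ0 hcomp
  have hΨ : ∀ i x, Ψ (o i x) = τ i x := fun i x => Monoid.PushoutI.lift_of τ τ0 hcomp x
  refine RF_of_leftInverse Φ Ψ ?_ hP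
  refine hom_id Γ M U (Ψ.comp Φ) fun v => ?_
  rw [MonoidHom.comp_apply, hΦ]
  by_cases hu : v = u
  · have hw : v ≠ w := hu ▸ huw
    rw [Ft v hw, hΨ, hτ true v (fun h => (hmt v).2 ⟨hw, h⟩)]
  · rw [Ff v hu, hΨ, hτ false v (fun h => (hmf v).2 ⟨hu, h⟩)]

end

theorem fin3_RF (M : Fin 3 → Fin 3 → ℕ) (hsymm : ∀ a b, M a b = M b a)
    (heven : ∀ a b, (⊤ : SimpleGraph (Fin 3)).Adj a b → Even (M a b))
    (h6 : ∀ a b, a ≠ b → 6 ≤ M a b) :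
    ResiduallyFinite (KG (⊤ : SimpleGraph (Fin 3)) M Finset.univ) := by
  have ad : ∀ a b : Fin 3, a ≠ b → (⊤ : SimpleGraph (Fin 3)).Adj a b := fun a b h => by simpa using h
  have rel := fun a b h => gen_rel (⊤ : SimpleGraph (Fin 3)) M heven Finset.univ a b (ad a b h)
  have ge := fun a b h => h6 a b h
  refine tri_RF (gen _ M Finset.univ 0) (gen _ M Finset.univ 1) (gen _ M Finset.univ 2)
    (M 0 1 / 2) (M 1 2 / 2) (M 2 0 / 2)
    (by have := ge 0 1 (by decide); omega) (by have := ge 1 2 (by decide); omega)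
    (by have := ge 2 0 (by decide); omega)
    (rel 0 1 (by decide)) (rel 1 2 (by decide)) (rel 2 0 (by decide)) ?_ ?_
  · intro P _ a' b' c' h1 h2 h3
    obtain ⟨φ, hφ⟩ := exists_hom (⊤ : SimpleGraph (Fin 3)) M heven Finset.univ ![a', b', c']
      (by
        intro a b hab
        fin_cases a <;> fin_cases b
        · exact absurd hab (by simp)
        · exact h1
        · have := h3.symm; rw [hsymm] at this; exact this
        · have := h1.symm; rw [hsymm] at this; exact this
        · exact absurd hab (by simp)
        · exact h2
        · exact h3
        · have := h2.symm; rw [hsymm] at this; exact this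
        · exact absurd hab (by simp))
      (by intro v hv; simp at hv)
    exact ⟨φ, hφ 0, hφ 1, hφ 2⟩
  · intro f h0 h1 h2
    refine hom_id _ M Finset.univ f fun v => ?_
    fin_cases v
    · exact h0
    · exact h1
    · exact h2

theorem clique_RF {V : Type} [Nonempty V] (Γ : SimpleGraph V) (M : V → V → ℕ)
    (hsymm : ∀ a b, M a b = M b a)
    (heven : ∀ a b, Γ.Adj a b → Even (M a b)) (h6 : ∀ a b, Γ.Adj a b → 6 ≤ M a b)
    (U : Finset V) (hc : ∀ a ∈ U, ∀ b ∈ U, a ≠ b → Γ.Adj a b) (hU : U.card ≤ 3) :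
    ResiduallyFinite (KG Γ M U) := by
  obtain ⟨j, hj⟩ : ∃ j : V → Fin 3, Set.InjOn j U := by
    have hcard : Fintype.card U ≤ Fintype.card (Fin 3) := by simpa using hU
    obtain ⟨e⟩ := Function.Embedding.nonempty_of_card_le hcard
    refine ⟨fun v => if h : v ∈ U then e ⟨v, h⟩ else 0, fun a ha b hb hab => ?_⟩
    have ha' : a ∈ U := ha
    have hb' : b ∈ U := hb
    simp only [ha', hb', dif_pos] at hab
    simpa using e.injective hab
  let s : Fin 3 → V := Function.invFunOn j U
  let I : Fin 3 → Prop := fun i => ∃ v ∈ U, j v = i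
  have hs1 : ∀ i, I i → s i ∈ U := fun i hi => Function.invFunOn_mem (f := j) (s := (U : Set V)) hi
  have hs2 : ∀ i, I i → j (s i) = i := fun i hi => Function.invFunOn_eq (f := j) (s := (U : Set V)) hi
  have hs3 : ∀ v, v ∈ U → s (j v) = v := fun v hv =>
    hj (hs1 _ ⟨v, hv, rfl⟩) hv (hs2 _ ⟨v, hv, rfl⟩)
  have hI : ∀ v, v ∈ U → I (j v) := fun v hv => ⟨v, hv, rfl⟩
  have hadj : ∀ a b, I a → I b → a ≠ b → Γ.Adj (s a) (s b) := by
    intro a b ha hb hab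
    refine hc _ (hs1 a ha) _ (hs1 b hb) fun h => hab ?_
    rw [← hs2 a ha, ← hs2 b hb, h]
  let M' : Fin 3 → Fin 3 → ℕ := fun a b => if I a ∧ I b then M (s a) (s b) else 6
  have hM' : ∀ a b, I a → I b → M' a b = M (s a) (s b) := fun a b ha hb => by simp [M', ha, hb]
  have hM'' : ∀ a b, ¬ (I a ∧ I b) → M' a b = 6 := fun a b h => by simp only [M', if_neg h]
  have ev' : ∀ a b, (⊤ : SimpleGraph (Fin 3)).Adj a b → Even (M' a b) := by
    intro a b hab
    by_cases h : I a ∧ I b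
    · rw [hM' a b h.1 h.2]; exact heven _ _ (hadj a b h.1 h.2 hab.ne)
    · rw [hM'' a b h]; decide
  have hT : ResiduallyFinite (KG (⊤ : SimpleGraph (Fin 3)) M' Finset.univ) := by
    apply fin3_RF M' _ ev'
    · intro a b hab
      by_cases h : I a ∧ I b
      · rw [hM' a b h.1 h.2]; exact h6 _ _ (hadj a b h.1 h.2 hab)
      · rw [hM'' a b h]
    · intro a b
      by_cases h : I a ∧ I b
      · rw [hM' a b h.1 h.2, hM' b a h.2 h.1, hsymm]
      · rw [hM'' a b h, hM'' b a (fun h' => h h'.symm)]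
  obtain ⟨Φ, hΦ⟩ := exists_hom Γ M heven U
    (fun v => if v ∈ U then gen (⊤ : SimpleGraph (Fin 3)) M' Finset.univ (j v) else 1)
    (by
      intro a b hab
      by_cases ha : a ∈ U <;> by_cases hb : b ∈ U <;> simp [ha, hb]
      have e : M a b = M' (j a) (j b) := by
        rw [hM' _ _ (hI a ha) (hI b hb), hs3 a ha, hs3 b hb]
      rw [e]
      refine gen_rel _ M' ev' _ _ _ ?_
      simpa using fun h => hab.ne (hj ha hb h))
    (by intro v hv; simp [hv])
  obtain ⟨Ψ, hΨ⟩ := exists_hom (⊤ : SimpleGraph (Fin 3)) M' ev' Finset.univ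
    (fun i => if I i then gen Γ M U (s i) else 1)
    (by
      intro a b hab
      by_cases ha : I a <;> by_cases hb : I b <;> simp [ha, hb]
      rw [hM' a b ha hb]
      exact gen_rel Γ M heven _ _ _ (hadj a b ha hb hab.ne))
    (by intro v hv; simp at hv)
  refine RF_of_leftInverse Φ Ψ ?_ hT
  refine hom_id Γ M U (Ψ.comp Φ) fun v => ?_
  rw [MonoidHom.comp_apply, hΦ]
  by_cases hv : v ∈ U
  · simp [hv, hΨ, hI v hv, hs3 v hv]
  · simp [hv, gen_one Γ M U v hv]

theorem middle {V : Type} (Γ : SimpleGraph V) (M : V → V → ℕ) (D : V → V → Prop)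
    (hD : IsAdmissibleOrientation Γ M D) (p q r : V) (hpq : Γ.Adj p q) (hqr : Γ.Adj q r)
    (hrp : Γ.Adj r p) : ¬ (D p q ∧ D r q) ∧ ¬ (D q p ∧ D q r) := by
  let c : ZMod 3 → V := (![p, q, r] : Fin 3 → V)
  have hc : Γ.IsCycleMap c := by
    constructor
    · intro i
      change Fin 3 at i
      fin_cases i
      · exact hpq
      · exact hqr
      · exact hrp
    · intro i
      change Fin 3 at i
      fin_cases i
      · exact hrp.ne
      · exact hpq.ne
      · exact hqr.ne
  have hp : Γ.IsPathMap 2 (fun i => c (i : ZMod 3)) := by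
    constructor
    · intro i hi
      interval_cases i
      · exact hpq
      · exact hqr
    · intro i hi
      obtain rfl : i = 0 := by omega
      exact hrp.ne
  have main : ∀ b : Bool, (D p q → b = true) → (D q p → b = false) →
      (D q r → b = false) → (D r q → b = true) → False := by
    intro b h1 h2 h3 h4
    refine hD.no_almost_misdirected 3 (by norm_num) c ⟨hc, le_refl 2, hp,
      fun i => if i = 0 then b else !b, ?_, ?_⟩
    · intro i hi
      obtain rfl : i = 0 := by omega
      simp
    · intro i hi
      have hi' : i < 2 := hi
      interval_cases i
      · exact ⟨h1, h2⟩
      · refine ⟨fun h => ?_, fun h => ?_⟩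
        · have := h3 h; simp [this]
        · have := h4 h; simp [this]
  constructor
  · rintro ⟨h1, h2⟩
    exact main true (fun _ => rfl) (fun h => (hD.not_both _ _ ⟨h1, h⟩).elim)
      (fun h => (hD.not_both _ _ ⟨h2, h⟩).elim) (fun _ => rfl)
  · rintro ⟨h1, h2⟩
    exact main false (fun h => (hD.not_both _ _ ⟨h1, h⟩).elim) (fun _ => rfl)
      (fun _ => rfl) (fun h => (hD.not_both _ _ ⟨h2, h⟩).elim)

theorem clique_card {V : Type} (Γ : SimpleGraph V) (M : V → V → ℕ)
    (h6 : ∀ a b, Γ.Adj a b → 6 ≤ M a b) (D : V → V → Prop)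
    (hD : IsAdmissibleOrientation Γ M D)
    (U : Finset V) (hc : ∀ a ∈ U, ∀ b ∈ U, a ≠ b → Γ.Adj a b) : U.card ≤ 3 := by
  by_contra hlt
  obtain ⟨x, hx⟩ : U.Nonempty := by
    rw [← Finset.card_pos]; omega
  have h2 : 2 < (U.erase x).card := by
    rw [Finset.card_erase_of_mem hx]; omega
  obtain ⟨a, b, c, ha, hb, hc', hab, hac, hbc⟩ := Finset.two_lt_card_iff.1 h2
  rw [Finset.mem_erase] at ha hb hc'
  have or : ∀ v, v ≠ x ∧ v ∈ U → D x v ∨ D v x := fun v hv => by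
    have ad := hc x hx v hv.2 hv.1.symm
    exact (hD.defined_iff x v ad).2 (le_trans (by norm_num) (h6 x v ad))
  have mid : ∀ v w, v ≠ x ∧ v ∈ U → w ≠ x ∧ w ∈ U → v ≠ w →
      ¬ (D v x ∧ D w x) ∧ ¬ (D x v ∧ D x w) := fun v w hv hw hvw =>
    middle Γ M D hD v x w (hc v hv.2 x hx hv.1) (hc x hx w hw.2 hw.1.symm)
      (hc w hw.2 v hv.2 hvw.symm)
  have := mid a b ha hb hab
  have := mid a c ha hc' hac
  have := mid b c hb hc' hbc
  have := or a ha
  have := or b hb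
  have := or c hc'
  tauto

theorem main_RF {V : Type} [Fintype V]
    (Γ : SimpleGraph V) (hconn : Γ.Connected)
    (M : V → V → ℕ) (hsymm : ∀ a b, M a b = M b a)
    (heven : ∀ a b, Γ.Adj a b → Even (M a b)) (h6 : ∀ a b, Γ.Adj a b → 6 ≤ M a b)
    (hadm : ∃ D : V → V → Prop, IsAdmissibleOrientation Γ M D) :
    ResiduallyFinite (ArtinGroup Γ M) := by
  obtain ⟨D, hD⟩ := hadm
  have : Nonempty V := hconn.nonempty
  have key : ∀ n (U : Finset V), U.card = n → ResiduallyFinite (KG Γ M U) := by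
    intro n
    induction n using Nat.strong_induction_on with
    | _ n ih =>
      intro U hU
      by_cases hc : ∀ a ∈ U, ∀ b ∈ U, a ≠ b → Γ.Adj a b
      · exact clique_RF Γ M hsymm heven h6 U hc (clique_card Γ M h6 D hD U hc)
      · push Not at hc
        obtain ⟨u, hu, w, hw, huw, hn⟩ := hc
        refine split_RF Γ M heven hsymm U u w huw hn fun i => ?_
        refine ih _ ?_ _ rfl
        rw [← hU]
        cases i
        · exact Finset.card_lt_card (Finset.erase_ssubset hu)
        · exact Finset.card_lt_card (Finset.erase_ssubset hw)
  have hE : KRels Γ M Finset.univ = artinRels Γ M := by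
    simp [KRels]
  have h := key _ Finset.univ rfl
  unfold KG at h
  rw [hE] at h
  exact h

end RFArt

end

theorem artinGroup_allEven_ge6_residuallyFinite {V : Type} [Fintype V]
    (Γ : SimpleGraph V) (hconn : Γ.Connected)
    (M : V → V → ℕ) (hsymm : ∀ a b, M a b = M b a)
    (heven : ∀ a b, Γ.Adj a b → Even (M a b)) (h6 : ∀ a b, Γ.Adj a b → 6 ≤ M a b)
    (hadm : ∃ D : V → V → Prop, IsAdmissibleOrientation Γ M D) :
    ResiduallyFinite (ArtinGroup Γ M) := by
  exact RFArt.main_RF Γ hconn M hsymm heven h6 hadm
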